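/- Let p be a prime, t an integer with 1 ≤ t ≤ p − 1, and e(z) = exp(2πiz). Let F_{t,p}(s) be the holomorphic function on {Re s > 1/2} satisfying Σ_{n≥1} e(w(n)t/p)·n^{−s} = exp(e(t/p)·log ζ(s))·F_{t,p}(s) for Re s > 1, where log ζ(s) = Σ_{q prime} Σ_{m≥1} 1/(m·q^{ms}). Then Σ_{n≤N} e(w(n)t/p) = (F_{t,p}(1)/Γ(e(t/p)))·N·(log N)^{e(t/p)−1} + O(N·(log N)^{cos(2πt/p)−2}), where (log N)^{z} = exp(z·log log N) for complex z. -/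

import Mathlib

/-- `e(x) = exp(2πix)`. -/
noncomputable def eTwoPi (x : ℝ) : ℂ := Complex.exp (2 * Real.pi * Complex.I * x)

/-- The series `Σ_{q prime} Σ_{m ≥ 1} 1/(m·q^{ms})`, which equals `log ζ(s)` for `Re s > 1`. -/
noncomputable def logZetaSeries (s : ℂ) : ℂ :=
  ∑' (q : Nat.Primes) (m : ℕ), 1 / ((m + 1) * ((q : ℕ) : ℂ) ^ (((m : ℂ) + 1) * s))

section
open Complex Set Filter Topology

noncomputable def zv (n : ℕ) (s : ℂ) : ℂ :=
  ((n : ℂ) + 1) ^ (-s) - (((n : ℂ) + 1) ^ (1 - s) - ((n : ℂ) + 2) ^ (1 - s)) / (s - 1)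

lemma zv_eq_integral (n : ℕ) {s : ℂ} (hs : s ≠ 1) :
    zv n s = ∫ u in ((n : ℝ) + 1)..((n : ℝ) + 2), (((n : ℂ) + 1) ^ (-s) - (u : ℂ) ^ (-s)) := by
  have h1 : ∫ u in ((n : ℝ) + 1)..((n : ℝ) + 2), (u : ℂ) ^ (-s) =
      (((n : ℂ) + 2) ^ (1 - s) - ((n : ℂ) + 1) ^ (1 - s)) / (1 - s) := by
    rw [integral_cpow]
    · push_cast
      rw [show -s + 1 = 1 - s by ring]
    · right
      refine ⟨fun h => hs ?_, ?_⟩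
      · simpa using h
      · rw [Set.uIcc_of_le (by linarith)]
        intro h
        have := h.1
        have : (0:ℝ) ≤ n := n.cast_nonneg
        linarith
  have hIntg : IntervalIntegrable (fun u : ℝ => (u : ℂ) ^ (-s)) MeasureTheory.volume
      ((n : ℝ) + 1) ((n : ℝ) + 2) := by
    apply intervalIntegral.intervalIntegrable_cpow
    right
    rw [Set.uIcc_of_le (by linarith)]
    intro h
    have := h.1
    have : (0:ℝ) ≤ n := n.cast_nonneg
    linarith
  rw [intervalIntegral.integral_sub (by simp) hIntg, h1]
  simp only [intervalIntegral.integral_const]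
  have h3 : s - 1 ≠ 0 := sub_ne_zero.2 hs
  have h4 : 1 - s ≠ 0 := sub_ne_zero.2 hs.symm
  unfold zv
  have : (1 - s) = -(s - 1) := by ring
  rw [show ((n : ℝ) + 2 - (n + 1)) = 1 by ring]
  simp only [one_smul]
  rw [this, div_neg]
  ring

lemma norm_cpow_diff (m u : ℝ) (hm : 1 ≤ m) (hu : m ≤ u) (hu2 : u ≤ m + 1) (s : ℂ)
    (hs : 0 ≤ s.re) :
    ‖(m : ℂ) ^ (-s) - (u : ℂ) ^ (-s)‖ ≤ ‖s‖ * m ^ (-s.re - 1) := by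
  have h0 : (0 : ℝ) < m := by linarith
  have hd : ∀ x ∈ Icc m u, HasDerivWithinAt (fun x : ℝ => (x : ℂ) ^ (-s))
      (-s * (x : ℂ) ^ (-s - 1)) (Icc m u) x := by
    intro x hx
    have hx0 : (0 : ℝ) < x := by linarith [hx.1]
    by_cases hs0 : s = 0
    · subst hs0
      simpa using hasDerivWithinAt_const (x : ℝ) (Icc m u) (1 : ℂ)
    have := hasDerivAt_ofReal_cpow_const hx0.ne' (r := -s) (by simpa using hs0)
    exact this.hasDerivWithinAt
  have hb : ∀ x ∈ Ico m u, ‖-s * (x : ℂ) ^ (-s - 1)‖ ≤ ‖s‖ * m ^ (-s.re - 1) := by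
    intro x hx
    have hx0 : (0 : ℝ) < x := by linarith [hx.1]
    rw [norm_mul, norm_neg, norm_cpow_eq_rpow_re_of_pos hx0]
    gcongr
    simp only [sub_re, neg_re, one_re]
    exact Real.rpow_le_rpow_of_nonpos h0 hx.1 (by linarith)
  have := norm_image_sub_le_of_norm_deriv_le_segment' hd hb u ⟨hu, le_rfl⟩
  rw [norm_sub_rev]
  refine this.trans ?_
  have : 0 ≤ ‖s‖ * m ^ (-s.re - 1) := by positivity
  nlinarith

lemma norm_cpow_diff' (m u : ℝ) (hm : 1 ≤ m) (hu : m ≤ u) (hu2 : u ≤ m + 1) (s : ℂ)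
    (hs : 0 ≤ s.re) (δ : ℝ) (hδ : 0 ≤ δ) (hδ1 : δ ≤ 1) :
    ‖(m : ℂ) ^ (-s) - (u : ℂ) ^ (-s)‖ ≤ 2 * ‖s‖ ^ δ * m ^ (-s.re - δ) := by
  have h0 : (0 : ℝ) < m := by linarith
  set X := ‖(m : ℂ) ^ (-s) - (u : ℂ) ^ (-s)‖
  have hX : 0 ≤ X := norm_nonneg _
  have h1 : X ≤ ‖s‖ * m ^ (-s.re - 1) := norm_cpow_diff m u hm hu hu2 s hs
  have h2 : X ≤ 2 * m ^ (-s.re) := by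
    refine (norm_sub_le _ _).trans ?_
    rw [norm_cpow_eq_rpow_re_of_pos h0, norm_cpow_eq_rpow_re_of_pos (by linarith : 0 < u)]
    have : u ^ (-s).re ≤ m ^ (-s).re := Real.rpow_le_rpow_of_nonpos h0 hu (by simpa using hs)
    simp only [neg_re] at *
    linarith
  have h3 : X = X ^ δ * X ^ (1 - δ) := by
    by_cases hX0 : X = 0
    · rw [hX0]
      rcases eq_or_ne δ 0 with h | h
      · simp [h]
      · rw [Real.zero_rpow h]; simp
    · rw [← Real.rpow_add (lt_of_le_of_ne hX (Ne.symm hX0))]; simp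
  rw [h3]
  calc X ^ δ * X ^ (1 - δ) ≤ (‖s‖ * m ^ (-s.re - 1)) ^ δ * (2 * m ^ (-s.re)) ^ (1 - δ) := by
        gcongr
    _ = ‖s‖ ^ δ * 2 ^ (1 - δ) * m ^ (-s.re - δ) := by
        rw [Real.mul_rpow (by positivity) (by positivity), Real.mul_rpow (by positivity) (by positivity),
          ← Real.rpow_mul h0.le, ← Real.rpow_mul h0.le]
        rw [show -s.re - δ = (-s.re - 1) * δ + (-s.re) * (1 - δ) by ring, Real.rpow_add h0]
        ring
    _ ≤ ‖s‖ ^ δ * 2 * m ^ (-s.re - δ) := by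
        gcongr
        calc (2:ℝ) ^ (1 - δ) ≤ 2 ^ (1:ℝ) := Real.rpow_le_rpow_of_exponent_le (by norm_num) (by linarith)
          _ = 2 := by simp
    _ = _ := by ring

lemma norm_zv_le (n : ℕ) {s : ℂ} (hs1 : s ≠ 1) (hs : 0 ≤ s.re) (δ : ℝ) (hδ : 0 ≤ δ) (hδ1 : δ ≤ 1) :
    ‖zv n s‖ ≤ 2 * ‖s‖ ^ δ * ((n : ℝ) + 1) ^ (-s.re - δ) := by
  rw [zv_eq_integral n hs1]
  have h := intervalIntegral.norm_integral_le_of_norm_le_const (a := (n : ℝ) + 1) (b := (n : ℝ) + 2)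
    (f := fun u : ℝ => ((n : ℂ) + 1) ^ (-s) - (u : ℂ) ^ (-s))
    (C := 2 * ‖s‖ ^ δ * ((n : ℝ) + 1) ^ (-s.re - δ)) (by
      intro u hu
      rw [Set.uIoc_of_le (by linarith)] at hu
      have := norm_cpow_diff' ((n : ℝ) + 1) u (by linarith [(n.cast_nonneg : (0:ℝ) ≤ n)]) hu.1.le
        (by linarith [hu.2]) s hs δ hδ hδ1
      push_cast at this
      exact this)
  refine h.trans (le_of_eq ?_)
  rw [show ((n : ℝ) + 2 - (n + 1)) = 1 by ring]
  simp

lemma summable_aux {a : ℝ} (ha : 1 < a) : Summable (fun n : ℕ => ((n : ℝ) + 1) ^ (-a)) := by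
  have := (summable_nat_add_iff 1).2 (Real.summable_nat_rpow.2 (by linarith : -a < -1))
  simpa using this

lemma tsum_zv_of_one_lt {s : ℂ} (hs : 1 < s.re) : ∑' n, zv n s = riemannZeta s - (s - 1)⁻¹ := by
  have hs1 : s ≠ 1 := by rintro rfl; simp at hs
  have hsum : Summable (fun n => zv n s) := by
    apply Summable.of_norm_bounded (g := fun n : ℕ => 2 * ‖s‖ ^ (0:ℝ) * ((n : ℝ) + 1) ^ (-s.re - 0))
    · apply Summable.mul_left
      simpa using summable_aux hs
    · intro n
      exact norm_zv_le n hs1 (by linarith) 0 le_rfl zero_le_one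
  have hz : HasSum (fun n : ℕ => ((n : ℂ) + 1) ^ (-s)) (riemannZeta s) := by
    rw [zeta_eq_tsum_one_div_nat_add_one_cpow hs]
    have : Summable (fun n : ℕ => 1 / ((n : ℂ) + 1) ^ s) := by
      have := (summable_nat_add_iff 1).2 (Complex.summable_one_div_nat_cpow.2 hs)
      simpa using this
    convert this.hasSum using 2 with n
    rw [cpow_neg, one_div]
  have hd := hz.sub hsum.hasSum
  have hT : Tendsto (fun N : ℕ => ∑ n ∈ Finset.range N, (((n : ℂ) + 1) ^ (-s) - zv n s)) atTop
      (𝓝 ((s - 1)⁻¹)) := by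
    have h1 : ∀ N : ℕ, ∑ n ∈ Finset.range N, (((n : ℂ) + 1) ^ (-s) - zv n s)
        = (1 - ((N : ℂ) + 1) ^ (1 - s)) / (s - 1) := by
      intro N
      induction N with
      | zero => simp
      | succ N ih =>
        rw [Finset.sum_range_succ, ih]
        unfold zv
        push_cast
        rw [show (N : ℂ) + 1 + 1 = N + 2 by ring]
        ring
    simp_rw [h1]
    have h2 : Tendsto (fun N : ℕ => ((N : ℂ) + 1) ^ (1 - s)) atTop (𝓝 0) := by
      rw [tendsto_zero_iff_norm_tendsto_zero]
      have h3 : ∀ N : ℕ, ‖((N : ℂ) + 1) ^ (1 - s)‖ = ((N + 1 : ℕ) : ℝ) ^ (-(s.re - 1)) := by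
        intro N
        have := norm_cpow_eq_rpow_re_of_pos (by positivity : (0:ℝ) < (N:ℝ) + 1) (1 - s)
        push_cast at this ⊢
        rw [this]
        simp
      simp_rw [h3]
      exact ((tendsto_rpow_neg_atTop (by linarith : 0 < s.re - 1)).comp
        tendsto_natCast_atTop_atTop).comp (tendsto_add_atTop_nat 1)
    have h4 := ((tendsto_const_nhds (x := (1:ℂ))).sub h2).div_const (s - 1)
    simpa using h4
  have := tendsto_nhds_unique hd.tendsto_sum_nat hT
  rw [← this]; ring

lemma tsum_zv_eq {δ : ℝ} (hδ : 0 < δ) (hδ1 : δ ≤ 1) (c : ℝ) {s : ℂ} (hs : 1 - δ / 2 < s.re)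
    (hc : 0 < c * s.im) : ∑' n, zv n s = riemannZeta s - (s - 1)⁻¹ := by
  set U : Set ℂ := {s : ℂ | 1 - δ / 2 < s.re} ∩ {s | 0 < c * s.im} with hU
  have hUo : IsOpen U := (isOpen_lt continuous_const Complex.continuous_re).inter
    (isOpen_lt continuous_const (continuous_const.mul Complex.continuous_im))
  have hconv : Convex ℝ U := by
    apply (convex_halfSpace_re_gt _).inter
    apply convex_halfSpace_gt (f := fun s : ℂ => c * s.im)
    exact ⟨fun x y => by simp [mul_add], fun r x => by simp; ring⟩
  have hne : ∀ s ∈ U, s ≠ 1 := by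
    rintro s ⟨_, h⟩ rfl
    simp at h
  have hdz : ∀ n, DifferentiableOn ℂ (zv n) U := by
    intro n s hs
    have h1 : ((n : ℂ) + 1) ≠ 0 := by exact_mod_cast Nat.succ_ne_zero n
    have h2 : ((n : ℂ) + 2) ≠ 0 := by exact_mod_cast Nat.succ_ne_zero (n+1)
    have h3 := sub_ne_zero.2 (hne s hs)
    apply DifferentiableAt.differentiableWithinAt
    unfold zv
    apply DifferentiableAt.sub
    · exact (differentiableAt_id.neg).const_cpow (Or.inl h1)
    · refine DifferentiableAt.fun_div (d := fun s : ℂ => s - 1) ?_ ?_ h3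
      · exact ((differentiableAt_const _).sub differentiableAt_id).const_cpow (Or.inl h1) |>.sub
          (((differentiableAt_const _).sub differentiableAt_id).const_cpow (Or.inl h2))
      · fun_prop
  -- local bound gives differentiability on U
  have hdiff : DifferentiableOn ℂ (fun s => ∑' n, zv n s) U := by
    intro s0 hs0
    set V := U ∩ {s : ℂ | ‖s‖ < ‖s0‖ + 1}
    have hVo : IsOpen V := hUo.inter (isOpen_lt continuous_norm continuous_const)
    have hV : DifferentiableOn ℂ (fun s => ∑' n, zv n s) V := by
      apply differentiableOn_tsum_of_summable_norm
        (u := fun n : ℕ => 2 * (‖s0‖ + 1) ^ δ * ((n : ℝ) + 1) ^ (-(1 + δ / 2)))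
      · exact (summable_aux (by linarith)).mul_left _
      · exact fun n => (hdz n).mono inter_subset_left
      · exact hVo
      · rintro n w ⟨hw, hw2⟩
        have hwre : 1 - δ / 2 < w.re := hw.1
        refine (norm_zv_le n (hne w hw) (by linarith) δ hδ.le hδ1).trans ?_
        simp only [mem_ofPred_eq] at hw2
        gcongr
        · linarith [(n.cast_nonneg : (0:ℝ) ≤ n)]
        · linarith
    exact (hV.differentiableAt (hVo.mem_nhds ⟨hs0, by simp⟩)).differentiableWithinAt
  have ha1 : AnalyticOnNhd ℂ (fun s => ∑' n, zv n s) U := hdiff.analyticOnNhd hUo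
  have ha2 : AnalyticOnNhd ℂ (fun s => riemannZeta s - (s - 1)⁻¹) U := by
    apply DifferentiableOn.analyticOnNhd _ hUo
    intro s hs
    apply DifferentiableAt.differentiableWithinAt
    exact (differentiableAt_riemannZeta (hne s hs)).sub
      ((differentiableAt_id.sub_const 1).inv (sub_ne_zero.2 (hne s hs)))
  have hmem : s + 1 ∈ U := ⟨by simp only [mem_ofPred_eq, add_re, one_re]; linarith, by simpa using hc⟩
  have := ha1.eqOn_of_preconnected_of_eventuallyEq ha2 hconv.isPreconnected hmem (by
    have : {s : ℂ | 1 < s.re} ∈ 𝓝 (s + 1) := (isOpen_lt continuous_const Complex.continuous_re).mem_nhds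
      (by simp only [mem_ofPred_eq, add_re, one_re]; linarith)
    filter_upwards [this] with w hw
    exact tsum_zv_of_one_lt hw)
  exact this ⟨hs, hc⟩

lemma zeta0_bound {δ : ℝ} (hδ : 0 < δ) (hδ1 : δ ≤ 1) : ∃ C, 0 < C ∧ ∀ s : ℂ, 1 - δ / 4 ≤ s.re →
    s.re ≤ 3 → ‖riemannZeta₀ s‖ ≤ C * (1 + |s.im|) ^ δ := by
  have hcomp : IsCompact (reProdIm (Icc (0:ℝ) 3) (Icc (-1:ℝ) 1)) :=
    isCompact_Icc.reProdIm isCompact_Icc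
  obtain ⟨C1, hC1⟩ := hcomp.exists_bound_of_continuousOn
    differentiable_riemannZeta₀.continuous.continuousOn
  set S := ∑' n : ℕ, ((n : ℝ) + 1) ^ (-(1 + δ / 2))
  have hS : 0 ≤ S := tsum_nonneg fun n => by positivity
  refine ⟨|C1| + 2 * 4 ^ δ * S + 1, by positivity, fun s hs hs3 => ?_⟩
  have h1le : (1:ℝ) ≤ (1 + |s.im|) ^ δ := Real.one_le_rpow (by linarith [abs_nonneg s.im]) hδ.le
  rcases le_or_gt |s.im| 1 with h | h
  · have hmem : s ∈ reProdIm (Icc (0:ℝ) 3) (Icc (-1:ℝ) 1) := by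
      rw [Complex.mem_reProdIm]
      exact ⟨⟨by linarith, hs3⟩, abs_le.1 h⟩
    have := hC1 s hmem
    have h2 : 0 ≤ 2 * 4 ^ δ * S := by positivity
    nlinarith [le_abs_self C1, abs_nonneg C1]
  · have hs0 : s.im ≠ 0 := by intro h0; rw [h0] at h; simp at h; linarith
    have hs1 : s ≠ 1 := by rintro rfl; simp at hs0
    have hc : 0 < s.im * s.im := mul_self_pos.2 hs0
    have heq := tsum_zv_eq hδ hδ1 s.im (s := s) (by linarith) hc
    have : riemannZeta₀ s = ∑' n, zv n s := by
      rw [heq, riemannZeta_eq_inv_sub_add hs1]; ring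
    rw [this]
    have hnorm : ‖s‖ ≤ 4 * (1 + |s.im|) := by
      refine (Complex.norm_le_abs_re_add_abs_im s).trans ?_
      rw [abs_of_nonneg (by linarith : 0 ≤ s.re)]
      linarith
    have hsum : Summable (fun n : ℕ => 2 * ‖s‖ ^ δ * ((n : ℝ) + 1) ^ (-(1 + δ / 2))) :=
      (summable_aux (by linarith)).mul_left _
    calc ‖∑' n, zv n s‖ ≤ ∑' n : ℕ, 2 * ‖s‖ ^ δ * ((n : ℝ) + 1) ^ (-(1 + δ / 2)) := by
          apply tsum_of_norm_bounded hsum.hasSum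
          intro n
          refine (norm_zv_le n hs1 (by linarith) δ hδ.le hδ1).trans ?_
          gcongr
          · linarith [(n.cast_nonneg : (0:ℝ) ≤ n)]
          · linarith
      _ = 2 * ‖s‖ ^ δ * S := by rw [tsum_mul_left]
      _ ≤ 2 * (4 * (1 + |s.im|)) ^ δ * S := by gcongr
      _ = 2 * 4 ^ δ * S * (1 + |s.im|) ^ δ := by
          rw [Real.mul_rpow (by norm_num) (by positivity)]; ring
      _ ≤ _ := by
          gcongr
          linarith [abs_nonneg C1]
end

section
open Complex Set Filter Topology

def HP : Set ℂ := {s : ℂ | 1 < s.re}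

lemma isOpen_HP : IsOpen HP := isOpen_lt continuous_const Complex.continuous_re

def SubG (τ : ℝ) (f : ℂ → ℂ) : Prop := ∀ δ : ℝ, 0 < δ → ∃ C : ℝ, 1 ≤ C ∧ ∀ s : ℂ, 1 < s.re → s.re ≤ 2 →
  τ ≤ |s.im| → ‖f s‖ ≤ C * (1 + |s.im|) ^ δ

def SC (τ : ℝ) : ℕ → (ℂ → ℂ) → Prop
  | 0, f => DifferentiableOn ℂ f HP ∧ SubG τ f
  | n + 1, f => DifferentiableOn ℂ f HP ∧ SubG τ f ∧ SC τ n (deriv f)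

lemma SubG.congr {τ : ℝ} {f g : ℂ → ℂ} (hf : SubG τ f) (h : EqOn f g HP) : SubG τ g := by
  intro δ hδ
  obtain ⟨C, hC, H⟩ := hf δ hδ
  exact ⟨C, hC, fun s h1 h2 h3 => by rw [← h h1]; exact H s h1 h2 h3⟩

lemma SubG.add {τ : ℝ} {f g : ℂ → ℂ} (hf : SubG τ f) (hg : SubG τ g) : SubG τ (fun s => f s + g s) := by
  intro δ hδ
  obtain ⟨C, hC, H⟩ := hf δ hδ
  obtain ⟨C', hC', H'⟩ := hg δ hδ
  refine ⟨C + C', by linarith, fun s h1 h2 h3 => (norm_add_le _ _).trans ?_⟩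
  rw [add_mul]
  exact add_le_add (H s h1 h2 h3) (H' s h1 h2 h3)

lemma SubG.mul {τ : ℝ} {f g : ℂ → ℂ} (hf : SubG τ f) (hg : SubG τ g) : SubG τ (fun s => f s * g s) := by
  intro δ hδ
  obtain ⟨C, hC, H⟩ := hf (δ / 2) (by linarith)
  obtain ⟨C', hC', H'⟩ := hg (δ / 2) (by linarith)
  refine ⟨C * C', by nlinarith, fun s h1 h2 h3 => ?_⟩
  rw [norm_mul]
  have h0 : (0:ℝ) < 1 + |s.im| := by positivity
  calc _ ≤ (C * (1 + |s.im|) ^ (δ / 2)) * (C' * (1 + |s.im|) ^ (δ / 2)) :=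
        mul_le_mul (H s h1 h2 h3) (H' s h1 h2 h3) (norm_nonneg _) (by positivity)
    _ = C * C' * ((1 + |s.im|) ^ (δ / 2) * (1 + |s.im|) ^ (δ / 2)) := by ring
    _ = _ := by rw [← Real.rpow_add h0]; congr 2; ring

lemma SubG.of_bounded {τ : ℝ} {f : ℂ → ℂ} (B : ℝ)
    (h : ∀ s : ℂ, 1 < s.re → s.re ≤ 2 → τ ≤ |s.im| → ‖f s‖ ≤ B) : SubG τ f := by
  intro δ hδ
  refine ⟨max B 1, le_max_right _ _, fun s h1 h2 h3 => (h s h1 h2 h3).trans ?_⟩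
  have h1le : (1:ℝ) ≤ (1 + |s.im|) ^ δ := Real.one_le_rpow (by linarith [abs_nonneg s.im]) hδ.le
  have := le_max_left B 1
  have := le_max_right B 1
  nlinarith

lemma deriv_eqOn_HP {f g : ℂ → ℂ} (h : EqOn f g HP) : EqOn (deriv f) (deriv g) HP := by
  intro s hs
  apply Filter.EventuallyEq.deriv_eq
  filter_upwards [isOpen_HP.mem_nhds hs] with w hw using h hw

lemma SC.diff {τ : ℝ} {n : ℕ} {f : ℂ → ℂ} (hf : SC τ n f) : DifferentiableOn ℂ f HP := by
  cases n <;> exact hf.1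

lemma SC.subG {τ : ℝ} {n : ℕ} {f : ℂ → ℂ} (hf : SC τ n f) : SubG τ f := by
  cases n
  · exact hf.2
  · exact hf.2.1

lemma SC.congr {τ : ℝ} {n : ℕ} : ∀ {f g : ℂ → ℂ}, SC τ n f → EqOn f g HP → SC τ n g := by
  induction n with
  | zero => exact fun hf h => ⟨hf.1.congr fun s hs => (h hs).symm, hf.2.congr h⟩
  | succ n ih =>
    exact fun hf h => ⟨hf.1.congr fun s hs => (h hs).symm, hf.2.1.congr h,
      ih hf.2.2 (deriv_eqOn_HP h)⟩

lemma SC.of_succ {τ : ℝ} {n : ℕ} : ∀ {f : ℂ → ℂ}, SC τ (n + 1) f → SC τ n f := by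
  induction n with
  | zero => exact fun hf => ⟨hf.1, hf.2.1⟩
  | succ n ih => exact fun hf => ⟨hf.1, hf.2.1, ih hf.2.2⟩

lemma SC.add {τ : ℝ} {n : ℕ} : ∀ {f g : ℂ → ℂ}, SC τ n f → SC τ n g → SC τ n (fun s => f s + g s) := by
  induction n with
  | zero => exact fun hf hg => ⟨hf.1.fun_add hg.1, hf.2.add hg.2⟩
  | succ n ih =>
    intro f g hf hg
    refine ⟨hf.1.fun_add hg.1, hf.2.1.add hg.2.1, (ih hf.2.2 hg.2.2).congr ?_⟩
    intro s hs
    have h1 := hf.1.differentiableAt (isOpen_HP.mem_nhds hs)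
    have h2 := hg.1.differentiableAt (isOpen_HP.mem_nhds hs)
    exact (deriv_fun_add h1 h2).symm

lemma SC.mul {τ : ℝ} {n : ℕ} : ∀ {f g : ℂ → ℂ}, SC τ n f → SC τ n g → SC τ n (fun s => f s * g s) := by
  induction n with
  | zero => exact fun hf hg => ⟨hf.1.fun_mul hg.1, hf.2.mul hg.2⟩
  | succ n ih =>
    intro f g hf hg
    refine ⟨hf.1.fun_mul hg.1, hf.2.1.mul hg.2.1,
      ((ih hf.2.2 hg.of_succ).add (ih hf.of_succ hg.2.2)).congr ?_⟩
    intro s hs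
    have h1 := hf.1.differentiableAt (isOpen_HP.mem_nhds hs)
    have h2 := hg.1.differentiableAt (isOpen_HP.mem_nhds hs)
    exact (deriv_fun_mul h1 h2).symm

lemma SC.iteratedDeriv {τ : ℝ} {n : ℕ} : ∀ {f : ℂ → ℂ}, SC τ n f → SubG τ (iteratedDeriv n f) := by
  induction n with
  | zero => intro f hf; simpa using hf.2
  | succ n ih => intro f hf; rw [iteratedDeriv_succ']; exact ih hf.2.2

lemma SC.const (τ : ℝ) (n : ℕ) : ∀ (c : ℂ), SC τ n (fun _ => c) := by
  induction n with
  | zero => exact fun c => ⟨by fun_prop, SubG.of_bounded ‖c‖ (by simp)⟩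
  | succ n ih =>
    exact fun c => ⟨by fun_prop, SubG.of_bounded ‖c‖ (by simp), by simpa using ih 0⟩

/-- Functions extending a little to the left with sub-polynomial growth. -/
def BigG (f : ℂ → ℂ) : Prop := DifferentiableOn ℂ f {s | 3 / 4 < s.re} ∧
  ∀ δ : ℝ, 0 < δ → ∃ η : ℝ, 0 < η ∧ η < 1 / 4 ∧ ∃ C : ℝ, 1 ≤ C ∧ ∀ s : ℂ, 1 - η ≤ s.re → s.re ≤ 2 + η →
    ‖f s‖ ≤ C * (1 + |s.im|) ^ δ

lemma isOpen_34 : IsOpen {s : ℂ | 3 / 4 < s.re} := isOpen_lt continuous_const Complex.continuous_re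

lemma BigG.deriv {f : ℂ → ℂ} (hf : BigG f) : BigG (deriv f) := by
  refine ⟨hf.1.deriv isOpen_34, fun δ hδ => ?_⟩
  obtain ⟨η, h0, h1, C, hC, H⟩ := hf.2 δ hδ
  refine ⟨η / 2, by linarith, by linarith, C * 2 ^ δ / (η / 2), ?_, fun s hs1 hs2 => ?_⟩
  · rw [le_div_iff₀ (by linarith)]
    have : (1:ℝ) ≤ 2 ^ δ := Real.one_le_rpow (by norm_num) hδ.le
    nlinarith
  have hpt : ∀ w : ℂ, ‖w - s‖ ≤ η / 2 → |w.re - s.re| ≤ η / 2 ∧ |w.im - s.im| ≤ η / 2 := by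
    intro w hw
    exact ⟨by simpa using (Complex.abs_re_le_norm (w - s)).trans hw,
      by simpa using (Complex.abs_im_le_norm (w - s)).trans hw⟩
  have := Complex.norm_deriv_le_of_forall_mem_sphere_norm_le (c := s) (R := η / 2)
    (C := C * 2 ^ δ * (1 + |s.im|) ^ δ) (f := f) (by linarith) ?_ ?_
  · refine this.trans (le_of_eq (by ring))
  · apply DifferentiableOn.diffContOnCl
    apply hf.1.mono
    rw [closure_ball _ (by linarith)]
    intro w hw
    rw [Metric.mem_closedBall, dist_eq_norm] at hw
    have := abs_le.1 (hpt w hw).1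
    simp only [mem_ofPred_eq]
    linarith
  · intro w hw
    rw [mem_sphere_iff_norm] at hw
    have h2 := abs_le.1 (hpt w hw.le).1
    refine (H w (by linarith) (by linarith)).trans ?_
    rw [mul_assoc, ← Real.mul_rpow (by norm_num) (by positivity)]
    gcongr
    have h3 := (hpt w hw.le).2
    have := abs_sub_abs_le_abs_sub w.im s.im
    linarith [abs_nonneg s.im]

lemma BigG.SC {f : ℂ → ℂ} (τ : ℝ) (n : ℕ) (hf : BigG f) : SC τ n f := by
  have key : ∀ f, BigG f → DifferentiableOn ℂ f HP ∧ SubG τ f := by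
    intro f hf
    refine ⟨hf.1.mono fun s (hs : 1 < s.re) => (by simp only [mem_ofPred_eq]; linarith), fun δ hδ => ?_⟩
    obtain ⟨η, h0, h1, C, hC, H⟩ := hf.2 δ hδ
    exact ⟨C, hC, fun s h1 h2 _ => H s (by linarith) (by linarith)⟩
  induction n generalizing f with
  | zero => exact key f hf
  | succ n ih => exact ⟨(key f hf).1, (key f hf).2, ih hf.deriv⟩

lemma zeta0_BigG : BigG riemannZeta₀ := by
  refine ⟨differentiable_riemannZeta₀.differentiableOn, fun δ hδ => ?_⟩
  obtain ⟨C, hC, H⟩ := zeta0_bound (δ := min δ (1/2)) (by positivity) ((min_le_right _ _).trans (by norm_num))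
  have hm : min δ (1/2) ≤ 1/2 := min_le_right _ _
  have hm0 : 0 < min δ (1/2) := by positivity
  refine ⟨min δ (1/2) / 4, by positivity, by linarith, max C 1, le_max_right _ _, fun s h1 h2 => ?_⟩
  refine (H s h1 (by linarith)).trans ?_
  gcongr
  · exact le_max_left _ _
  · linarith [abs_nonneg s.im]
  · exact min_le_left _ _

lemma SC_inv_pow {τ : ℝ} (hτ : 0 < τ) (n : ℕ) : ∀ (c : ℂ) (m : ℕ), SC τ n (fun s => c * ((s - 1)⁻¹) ^ m) := by
  have hne : ∀ s ∈ HP, s - 1 ≠ 0 := by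
    intro s hs h
    have : s = 1 := sub_eq_zero.1 h
    subst this
    simp [HP] at hs
  have hd : ∀ s ∈ HP, ∀ (c : ℂ) (m : ℕ), HasDerivAt (fun s : ℂ => c * ((s - 1)⁻¹) ^ m)
      ((-c * m) * ((s - 1)⁻¹) ^ (m + 1)) s := by
    intro s hs c m
    have h1 : HasDerivAt (fun s : ℂ => (s - 1)⁻¹) (-1 / (s - 1) ^ 2) s :=
      ((hasDerivAt_id s).sub_const 1).fun_inv (hne s hs)
    refine ((h1.fun_pow m).const_mul c).congr_deriv ?_
    rcases m with _ | m
    · simp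
    · have := hne s hs
      simp only [Nat.add_sub_cancel, inv_pow]
      field_simp
      ring
  have key : ∀ (c : ℂ) (m : ℕ), DifferentiableOn ℂ (fun s => c * ((s - 1)⁻¹) ^ m) HP ∧
      SubG τ (fun s => c * ((s - 1)⁻¹) ^ m) := by
    intro c m
    refine ⟨fun s hs => (hd s hs c m).differentiableAt.differentiableWithinAt,
      SubG.of_bounded (‖c‖ * (τ⁻¹) ^ m) fun s h1 h2 h3 => ?_⟩
    rw [norm_mul, norm_pow, norm_inv]
    gcongr
    refine h3.trans ?_
    simpa using Complex.abs_im_le_norm (s - 1)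
  induction n with
  | zero => exact key
  | succ n ih =>
    intro c m
    exact ⟨(key c m).1, (key c m).2, (ih (-c * m) (m + 1)).congr fun s hs => ((hd s hs c m).deriv).symm⟩

lemma HP_ne_one {s : ℂ} (hs : s ∈ HP) : s ≠ 1 := by
  rintro rfl; simp [HP] at hs

lemma zeta_SC {τ : ℝ} (hτ : 0 < τ) (n : ℕ) : SC τ n riemannZeta := by
  have := (SC_inv_pow hτ n 1 1).add (zeta0_BigG.SC τ n)
  refine this.congr fun s hs => ?_
  rw [riemannZeta_eq_inv_sub_add (HP_ne_one hs)]
  simp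

lemma zeta_real_bound : ∃ C : ℝ, 1 ≤ C ∧ ∀ x : ℝ, 0 < x → x ≤ 1 → ‖riemannZeta (1 + x)‖ ≤ C / x := by
  obtain ⟨C, hC, H⟩ := zeta0_bound (δ := 1) one_pos le_rfl
  refine ⟨1 + C, by linarith, fun x hx hx1 => ?_⟩
  have hne : (1 + x : ℂ) ≠ 1 := by simpa using hx.ne'
  rw [riemannZeta_eq_inv_sub_add hne]
  have h1 := H (1 + x) (by simp; linarith) (by simp; linarith)
  refine (norm_add_le _ _).trans ?_
  simp at h1 ⊢
  rw [abs_of_pos hx, add_div, one_div]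
  gcongr
  refine h1.trans ?_
  rw [le_div_iff₀ hx]
  nlinarith

lemma zeta_341 {x : ℝ} (hx : 0 < x) (y : ℝ) :
    1 ≤ ‖riemannZeta (1 + x)‖ ^ 3 * ‖riemannZeta (1 + x + I * y)‖ ^ 4 *
      ‖riemannZeta (1 + x + 2 * I * y)‖ := by
  have := DirichletCharacter.norm_LFunction_product_ge_one (N := 1) 1 hx y
  simpa [DirichletCharacter.LFunctionTrivChar, DirichletCharacter.LFunction_modOne_eq, norm_mul, norm_pow] using this
end

section
open Complex Set Filter Topology

lemma mvt_horizontal {f : ℂ → ℂ} (hf : DifferentiableOn ℂ f HP) {A x x' y : ℝ} (hx : 0 < x)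
    (hxx : x ≤ x') (hb : ∀ u : ℝ, x ≤ u → u ≤ x' → ‖deriv f (1 + u + I * y)‖ ≤ A) :
    ‖f (1 + x' + I * y) - f (1 + x + I * y)‖ ≤ A * (x' - x) := by
  have hd : ∀ u ∈ Icc x x', HasDerivWithinAt (fun u : ℝ => f (1 + u + I * y))
      (deriv f (1 + u + I * y)) (Icc x x') u := by
    intro u hu
    have hm : (1 + u + I * y : ℂ) ∈ HP := by
      simp only [HP, mem_ofPred_eq]; simp; linarith [hu.1]
    have h1 := (hf.differentiableAt (isOpen_HP.mem_nhds hm)).hasDerivAt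
    have h2 : HasDerivAt (fun u : ℝ => (1 + u + I * y : ℂ)) 1 u :=
      ((Complex.ofRealCLM.hasDerivAt (x := u)).const_add 1).add_const _
    have := HasDerivAt.comp u h1 h2
    simpa [Function.comp_def] using this.hasDerivWithinAt
  exact norm_image_sub_le_of_norm_deriv_le_segment' hd (fun u hu => hb u hu.1 hu.2.le) x' ⟨hxx, le_rfl⟩

lemma re_im_aux (x y : ℝ) : (1 + x + I * y : ℂ).re = 1 + x ∧ (1 + x + I * y : ℂ).im = y := by
  constructor <;> simp

lemma eq_aux (s : ℂ) : s = 1 + ((s.re - 1 : ℝ) : ℂ) + I * (s.im : ℂ) := by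
  apply Complex.ext <;> simp

set_option maxHeartbeats 1000000 in
lemma zeta_inv_SubG {τ : ℝ} (hτ : 0 < τ) : SubG τ (fun s => (riemannZeta s)⁻¹) := by
  intro δ hδ
  set δ' := min (δ / 7) 1 with hδ'
  have hδ'0 : 0 < δ' := by positivity
  obtain ⟨Ca, hCa, Ha⟩ := (zeta_SC hτ 1).subG δ' hδ'0
  obtain ⟨Cb, hCb, Hb⟩ := (zeta_SC hτ 1).2.2.subG δ' hδ'0
  obtain ⟨Cc, hCc, Hc⟩ := zeta_real_bound
  set C := Ca + Cb + Cc with hC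
  have hC1 : 1 ≤ C := by linarith
  refine ⟨32 * C ^ 7, by nlinarith [one_le_pow₀ hC1 (n := 7)], fun s hs1 hs2 hs3 => ?_⟩
  set y := s.im
  set B := (1 + |y|) ^ δ' with hB
  have hB1 : 1 ≤ B := Real.one_le_rpow (by linarith [abs_nonneg y]) hδ'0.le
  set A := C * B with hA
  have hA1 : 1 ≤ A := by nlinarith
  have hCA : C ≤ A := by nlinarith
  -- bound at 1 + x
  have hlow : ∀ x : ℝ, 0 < x → x ≤ 1 → x ^ 3 ≤ 2 * A ^ 4 * ‖riemannZeta (1 + x + I * y)‖ ^ 4 := by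
    intro x hx hx1
    have h1 := zeta_341 hx y
    have h2 : ‖riemannZeta (1 + x)‖ ≤ A / x := (Hc x hx hx1).trans (by gcongr; linarith)
    have h3 : ‖riemannZeta (1 + x + 2 * I * y)‖ ≤ 2 * A := by
      have hre : (1 + x + 2 * I * y : ℂ).re = 1 + x := by simp
      have him : (1 + x + 2 * I * y : ℂ).im = 2 * y := by simp
      have := Ha (1 + x + 2 * I * y) (by rw [hre]; linarith) (by rw [hre]; linarith)
        (by rw [him, abs_mul]; simp; linarith [abs_nonneg y])
      refine this.trans ?_
      rw [him]
      calc Ca * (1 + |2 * y|) ^ δ' ≤ C * (2 * (1 + |y|)) ^ δ' := by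
            gcongr
            · linarith
            · rw [abs_mul]; simp; linarith [abs_nonneg y]
        _ = C * (2 ^ δ' * B) := by rw [Real.mul_rpow (by norm_num) (by positivity)]
        _ ≤ C * (2 ^ (1:ℝ) * B) := by
            gcongr
            · norm_num
            · exact min_le_right _ _
        _ = 2 * A := by rw [hA]; simp; ring
    have h4 : 1 ≤ (A / x) ^ 3 * ‖riemannZeta (1 + x + I * y)‖ ^ 4 * (2 * A) := h1.trans (by gcongr)
    rw [div_pow] at h4
    have h5 : A ^ 3 / x ^ 3 * ‖riemannZeta (1 + x + I * y)‖ ^ 4 * (2 * A) =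
      (2 * A ^ 4 * ‖riemannZeta (1 + x + I * y)‖ ^ 4) / x ^ 3 := by ring
    rw [h5, le_div_iff₀ (by positivity)] at h4
    linarith
  set η := 1 / (32 * A ^ 8) with hη
  have hA8 : 1 ≤ A ^ 8 := one_le_pow₀ hA1
  have hη0 : 0 < η := by positivity
  have hη1 : η ≤ 1 := by
    rw [hη, div_le_one (by positivity)]; linarith
  have hAη : 32 * A ^ 8 * η = 1 := by rw [hη]; field_simp
  -- for x ≥ η
  have hbig : ∀ x : ℝ, η ≤ x → x ≤ 1 → 2 * A * η ≤ ‖riemannZeta (1 + x + I * y)‖ := by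
    intro x hx hx1
    have h1 := hlow x (by linarith) hx1
    have h2 : η ^ 3 ≤ x ^ 3 := by gcongr
    have h3 : (2 * A * η) ^ 4 * (2 * A ^ 4) = η ^ 3 := by
      calc (2 * A * η) ^ 4 * (2 * A ^ 4) = (32 * A ^ 8 * η) * η ^ 3 := by ring
        _ = _ := by rw [hAη]; ring
    have h4 : (2 * A * η) ^ 4 ≤ ‖riemannZeta (1 + x + I * y)‖ ^ 4 := by
      have : 0 < 2 * A ^ 4 := by positivity
      nlinarith
    exact le_of_pow_le_pow_left₀ (by norm_num) (norm_nonneg _) h4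
  have hmain : A * η ≤ ‖riemannZeta s‖ := by
    rw [eq_aux s]
    set x := s.re - 1 with hx
    have hx0 : 0 < x := by linarith
    have hx1 : x ≤ 1 := by linarith
    rcases le_or_gt η x with h | h
    · have := hbig x h hx1
      have : 0 < A * η := by positivity
      linarith
    · have h1 := mvt_horizontal (zeta_SC hτ 0).diff (A := A) (y := y) hx0 h.le (by
        intro u hu1 hu2
        have hr := re_im_aux u y
        refine (Hb (1 + u + I * y) (by rw [hr.1]; linarith) (by rw [hr.1]; linarith)
          (by rw [hr.2]; exact hs3)).trans ?_
        rw [hr.2]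
        exact mul_le_mul_of_nonneg_right (by linarith) (by linarith))
      have h2 := hbig η le_rfl hη1
      have h3 := norm_sub_norm_le (riemannZeta (1 + η + I * y)) (riemannZeta (1 + x + I * y))
      have h4 : A * (η - x) ≤ A * η := mul_le_mul_of_nonneg_left (by linarith) (by linarith)
      linarith
  have hAηpos : 0 < A * η := by positivity
  rw [norm_inv]
  calc ‖riemannZeta s‖⁻¹ ≤ (A * η)⁻¹ := by gcongr
    _ = 32 * A ^ 7 := by
        rw [hη]; field_simp
    _ = 32 * C ^ 7 * ((1 + |y|) ^ (δ' * 7)) := by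
        rw [hA, mul_pow, hB, Real.rpow_mul (by positivity)]
        norm_cast
        ring
    _ ≤ 32 * C ^ 7 * (1 + |y|) ^ δ := by
        gcongr
        · linarith [abs_nonneg y]
        · have := min_le_left (δ / 7) 1
          linarith

lemma zeta_ne_zero_HP {s : ℂ} (hs : s ∈ HP) : riemannZeta s ≠ 0 :=
  riemannZeta_ne_zero_of_one_lt_re hs

lemma zeta_inv_SC {τ : ℝ} (hτ : 0 < τ) (n : ℕ) : SC τ n (fun s => (riemannZeta s)⁻¹) := by
  have hd : DifferentiableOn ℂ (fun s => (riemannZeta s)⁻¹) HP := by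
    intro s hs
    exact ((differentiableAt_riemannZeta (HP_ne_one hs)).fun_inv (zeta_ne_zero_HP hs)).differentiableWithinAt
  induction n with
  | zero => exact ⟨hd, zeta_inv_SubG hτ⟩
  | succ n ih =>
    refine ⟨hd, zeta_inv_SubG hτ, ?_⟩
    refine (((SC.const τ n (-1)).mul ((zeta_SC hτ (n+1)).2.2)).mul (ih.mul ih)).congr ?_
    intro s hs
    have := ((differentiableAt_riemannZeta (HP_ne_one hs)).hasDerivAt.fun_inv (zeta_ne_zero_HP hs)).deriv
    rw [this]
    have := zeta_ne_zero_HP hs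
    field_simp

open ArithmeticFunction in
/-- log zeta as an L-series -/
noncomputable def LZ (s : ℂ) : ℂ := LSeries (fun (n : ℕ) ↦ (vonMangoldt n : ℂ) / Real.log n) s

lemma exp_LZ {s : ℂ} (hs : 1 < s.re) : exp (LZ s) = riemannZeta s := riemannZeta_eq_exp_LSeries hs

lemma LZ_coeff_norm (n : ℕ) : ‖((ArithmeticFunction.vonMangoldt n : ℂ) / Real.log n)‖ ≤ 1 := by
  rw [norm_div, Complex.norm_real, Complex.norm_real, Real.norm_of_nonneg ArithmeticFunction.vonMangoldt_nonneg,
    Real.norm_of_nonneg (Real.log_natCast_nonneg n)]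
  exact div_le_one_of_le₀ ArithmeticFunction.vonMangoldt_le_log (Real.log_natCast_nonneg n)

lemma LZ_summable {s : ℂ} (hs : 1 < s.re) :
    LSeriesSummable (fun (n : ℕ) ↦ (ArithmeticFunction.vonMangoldt n : ℂ) / Real.log n) s :=
  LSeriesSummable_of_bounded_of_one_lt_re (m := 1) (fun n _ => LZ_coeff_norm n) hs

lemma LZ_diff : DifferentiableOn ℂ LZ HP := by
  refine (LSeries_differentiableOn _).mono ?_
  intro s hs
  simp only [mem_ofPred_eq]
  refine lt_of_le_of_lt (LSeries.abscissaOfAbsConv_le_one_of_isBigO_one ?_) (by exact_mod_cast hs)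
  refine Asymptotics.IsBigO.of_bound 1 (Eventually.of_forall fun n => ?_)
  simpa using LZ_coeff_norm n

lemma exp_norm_LZ {s : ℂ} (hs : 1 < s.re) : Real.exp ‖LZ s‖ ≤ ‖riemannZeta (s.re : ℂ)‖ := by
  have hs' : 1 < ((s.re : ℝ) : ℂ).re := by simpa using hs
  have hpos : riemannZeta (s.re : ℂ) ≠ 0 := riemannZeta_ne_zero_of_one_lt_re hs'
  rw [← exp_LZ hs', Complex.norm_exp]
  apply Real.exp_le_exp.2
  have h1 : HasSum (fun n => LSeries.term (fun (n : ℕ) ↦ (ArithmeticFunction.vonMangoldt n : ℂ) / Real.log n) (s.re : ℂ) n)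
    (LZ (s.re : ℂ)) := (LZ_summable hs').hasSum
  have h2 := Complex.hasSum_re h1
  apply tsum_of_norm_bounded h2
  intro n
  rcases eq_or_ne n 0 with rfl | hn
  · simp
  rw [LSeries.term_of_ne_zero hn, LSeries.term_of_ne_zero hn, norm_div, norm_div, norm_natCast_cpow_of_pos (Nat.pos_of_ne_zero hn)]
  apply le_of_eq
  have : ((n : ℂ) ^ (s.re : ℂ)) = (((n : ℝ) ^ s.re : ℝ) : ℂ) := by
    rw [Complex.ofReal_cpow (by positivity)]; simp
  rw [this, Complex.norm_real, Complex.norm_real, Real.norm_of_nonneg ArithmeticFunction.vonMangoldt_nonneg,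
    Real.norm_of_nonneg (Real.log_natCast_nonneg n)]
  norm_cast

lemma LZ_deriv {s : ℂ} (hs : s ∈ HP) : deriv LZ s = deriv riemannZeta s * (riemannZeta s)⁻¹ := by
  have h1 := (LZ_diff.differentiableAt (isOpen_HP.mem_nhds hs)).hasDerivAt.cexp
  have h2 : deriv riemannZeta s = deriv (fun s => exp (LZ s)) s := by
    apply Filter.EventuallyEq.deriv_eq
    filter_upwards [isOpen_HP.mem_nhds hs] with w hw using (exp_LZ hw).symm
  rw [h2, h1.deriv, exp_LZ hs]
  have := zeta_ne_zero_HP hs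
  field_simp

noncomputable def ZZ (z : ℂ) (s : ℂ) : ℂ := exp (z * LZ s)

lemma ZZ_diff (z : ℂ) : DifferentiableOn ℂ (ZZ z) HP := (LZ_diff.const_mul z).cexp

lemma ZZ_SubG {τ : ℝ} (hτ : 0 < τ) {z : ℂ} (hz : ‖z‖ ≤ 1) : SubG τ (ZZ z) := by
  intro δ hδ
  obtain ⟨Ca, hCa, Ha⟩ := ((zeta_SC hτ 1).2.2.subG.mul (zeta_inv_SubG hτ)) δ hδ
  obtain ⟨Cc, hCc, Hc⟩ := zeta_real_bound
  refine ⟨Real.exp 1 * Cc * Ca, ?_, fun s hs1 hs2 hs3 => ?_⟩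
  · have := Real.add_one_le_exp 1
    have : 1 ≤ Cc * Ca := by nlinarith
    nlinarith
  set y := s.im
  have hB1 : 1 ≤ (1 + |y|) ^ δ := Real.one_le_rpow (by linarith [abs_nonneg y]) hδ.le
  set A := Ca * (1 + |y|) ^ δ with hA
  have hA1 : 1 ≤ A := by nlinarith
  have hbig : ∀ x : ℝ, A⁻¹ ≤ x → x ≤ 1 → Real.exp ‖LZ (1 + x + I * y)‖ ≤ Cc * A := by
    intro x hx hx1
    have hx0 : 0 < x := lt_of_lt_of_le (by positivity) hx
    have hr := re_im_aux x y
    refine (exp_norm_LZ (by rw [hr.1]; linarith)).trans ?_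
    rw [hr.1]
    push_cast
    refine (Hc x hx0 hx1).trans ?_
    rw [div_eq_mul_inv]
    gcongr
    exact inv_le_of_inv_le₀ (by positivity) hx
  have hmain : Real.exp ‖LZ s‖ ≤ Real.exp 1 * (Cc * A) := by
    have hA0 : 0 ≤ Cc * A := by positivity
    rw [eq_aux s]
    set x := s.re - 1 with hx
    have hx0 : 0 < x := by linarith
    have hx1 : x ≤ 1 := by linarith
    rcases le_or_gt A⁻¹ x with h | h
    · have := hbig x h hx1
      have := Real.add_one_le_exp 1
      nlinarith
    · have hAi : A⁻¹ ≤ 1 := inv_le_one_of_one_le₀ hA1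
      have h1 := mvt_horizontal LZ_diff (A := A) (y := y) hx0 h.le (by
        intro u hu1 hu2
        have hr := re_im_aux u y
        rw [LZ_deriv (by simp only [HP, mem_ofPred_eq]; rw [hr.1]; linarith)]
        refine (Ha (1 + u + I * y) (by rw [hr.1]; linarith) (by rw [hr.1]; linarith)
          (by rw [hr.2]; exact hs3)).trans ?_
        rw [hr.2])
      have h2 := hbig A⁻¹ le_rfl hAi
      have h3 : A * (A⁻¹ - x) ≤ 1 := by
        rw [mul_sub, mul_inv_cancel₀ (by positivity)]
        have : 0 < A * x := by positivity
        linarith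
      have h4 := norm_sub_norm_le (LZ (1 + x + I * y)) (LZ (1 + ((A⁻¹ : ℝ) : ℂ) + I * y))
      rw [norm_sub_rev] at h4
      calc Real.exp ‖LZ (1 + x + I * y)‖ ≤ Real.exp (1 + ‖LZ (1 + ((A⁻¹ : ℝ) : ℂ) + I * y)‖) := by
            apply Real.exp_le_exp.2; linarith
        _ = Real.exp 1 * Real.exp ‖LZ (1 + ((A⁻¹ : ℝ) : ℂ) + I * y)‖ := Real.exp_add _ _
        _ ≤ _ := by gcongr
  unfold ZZ
  rw [Complex.norm_exp]
  have h5 : (z * LZ s).re ≤ ‖LZ s‖ := by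
    refine (Complex.re_le_norm _).trans ?_
    rw [norm_mul]
    exact mul_le_of_le_one_left (norm_nonneg _) hz
  refine (Real.exp_le_exp.2 h5).trans (hmain.trans (le_of_eq ?_))
  rw [hA]; ring

lemma ZZ_SC {τ : ℝ} (hτ : 0 < τ) {z : ℂ} (hz : ‖z‖ ≤ 1) (n : ℕ) : SC τ n (ZZ z) := by
  induction n with
  | zero => exact ⟨ZZ_diff z, ZZ_SubG hτ hz⟩
  | succ n ih =>
    refine ⟨ZZ_diff z, ZZ_SubG hτ hz, ?_⟩
    refine (((SC.const τ n z).mul ((zeta_SC hτ (n+1)).2.2)).mul ((zeta_inv_SC hτ n).mul ih)).congr ?_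
    intro s hs
    have h1 := ((LZ_diff.differentiableAt (isOpen_HP.mem_nhds hs)).hasDerivAt.const_mul z).cexp
    have : deriv (ZZ z) s = _ := h1.deriv
    rw [this, LZ_deriv hs]
    simp only [ZZ]
    ring
end

section
open Complex Set Filter Topology

lemma pow_series_summable {b : ℕ → ℂ} (hb : ∀ e, ‖b e‖ ≤ 1) {x : ℂ} (hx : ‖x‖ < 1) :
    Summable (fun e => b e * x ^ e) := by
  refine Summable.of_norm_bounded (summable_geometric_of_lt_one (norm_nonneg x) hx) fun e => ?_
  rw [norm_mul, norm_pow]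
  exact mul_le_of_le_one_left (by positivity) (hb e)

lemma pow_series_tail {b : ℕ → ℂ} (hb : ∀ e, ‖b e‖ ≤ 1) (h0 : b 0 = 1) {x : ℂ} (hx : ‖x‖ ≤ 3/5) :
    ‖(∑' e, b e * x ^ e) - (1 + b 1 * x)‖ ≤ 5/2 * ‖x‖ ^ 2 := by
  have hx1 : ‖x‖ < 1 := by linarith
  have hs := pow_series_summable hb hx1
  rw [← hs.sum_add_tsum_nat_add 2]
  simp only [Finset.sum_range_succ, Finset.sum_range_zero, h0]
  rw [show (0 + 1 * x ^ 0 + b 1 * x ^ 1 + ∑' i, b (i + 2) * x ^ (i + 2)) - (1 + b 1 * x) =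
    ∑' i, b (i + 2) * x ^ (i + 2) by ring]
  have hg := (hasSum_geometric_of_lt_one (norm_nonneg x) hx1).mul_left (‖x‖ ^ 2)
  refine (tsum_of_norm_bounded hg fun i => ?_).trans ?_
  · rw [norm_mul, norm_pow, pow_add, mul_comm (‖x‖ ^ i)]
    exact mul_le_of_le_one_left (by positivity) (hb _)
  · rw [mul_comm]
    gcongr
    rw [inv_le_comm₀ (by linarith) (by norm_num)]
    linarith

lemma exp_log_tail {z : ℂ} (hz : ‖z‖ ≤ 1) {x : ℂ} (hx : ‖x‖ ≤ 3/5) :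
    ‖exp (z * log (1 - x)) - (1 - z * x)‖ ≤ 30 * ‖x‖ ^ 2 := by
  have hx1 : ‖-x‖ < 1 := by rw [norm_neg]; linarith
  have h1 := norm_log_one_add_sub_self_le hx1
  rw [norm_neg, ← sub_eq_add_neg, sub_neg_eq_add] at h1
  have hinv : (1 - ‖x‖)⁻¹ ≤ 5/2 := by
    rw [inv_le_comm₀ (by linarith) (by norm_num)]
    linarith
  have h1' : ‖log (1 - x) + x‖ ≤ 5/4 * ‖x‖ ^ 2 := by
    refine h1.trans ?_
    have : ‖x‖ ^ 2 * (1 - ‖x‖)⁻¹ ≤ ‖x‖ ^ 2 * (5/2) := by gcongr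
    linarith
  set v := z * log (1 - x) with hv
  have h2 : ‖v + z * x‖ ≤ 5/4 * ‖x‖ ^ 2 := by
    rw [hv, ← mul_add, norm_mul]
    exact (mul_le_of_le_one_left (norm_nonneg _) hz).trans h1'
  have hzx : ‖z * x‖ ≤ ‖x‖ := by rw [norm_mul]; exact mul_le_of_le_one_left (norm_nonneg _) hz
  have h3 : ‖v‖ ≤ 7/4 * ‖x‖ := by
    have : v = (v + z * x) - z * x := by ring
    rw [this]
    refine (norm_sub_le _ _).trans ?_
    nlinarith [norm_nonneg x]
  have h4 := norm_exp_sub_sum_le_norm_mul_exp v 2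
  simp only [Finset.sum_range_succ, Finset.sum_range_zero] at h4
  simp at h4
  have h5 : Real.exp ‖v‖ ≤ 9 := by
    have : ‖v‖ ≤ 2 := by linarith
    refine (Real.exp_le_exp.2 this).trans ?_
    have := Real.exp_one_lt_d9
    have h6 : Real.exp 2 = Real.exp 1 ^ 2 := by rw [← Real.exp_nat_mul]; norm_num
    rw [h6]
    nlinarith [Real.exp_pos 1]
  have h7 : ‖v‖ ^ 2 ≤ 49/16 * ‖x‖ ^ 2 := by
    have := pow_le_pow_left₀ (norm_nonneg v) h3 2
    nlinarith
  have h8 : ‖v‖ ^ 2 * Real.exp ‖v‖ ≤ 49/16 * ‖x‖ ^ 2 * 9 := by gcongr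
  have : exp v - (1 - z * x) = (exp v - (1 + v)) + (v + z * x) := by ring
  rw [this]
  refine (norm_add_le _ _).trans ?_
  nlinarith [sq_nonneg ‖x‖]

lemma local_factor {b : ℕ → ℂ} (hb : ∀ e, ‖b e‖ ≤ 1) (h0 : b 0 = 1) {x : ℂ} (hx : ‖x‖ ≤ 3/5) :
    ‖(∑' e, b e * x ^ e) * exp (b 1 * log (1 - x)) - 1‖ ≤ 100 * ‖x‖ ^ 2 := by
  have h1 := pow_series_tail hb h0 hx
  have h2 := exp_log_tail (hb 1) hx
  set P := ∑' e, b e * x ^ e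
  set G := exp (b 1 * log (1 - x))
  set r := P - (1 + b 1 * x) with hr
  set g := G - (1 - b 1 * x) with hg
  have hzx : ‖b 1 * x‖ ≤ ‖x‖ := by rw [norm_mul]; exact mul_le_of_le_one_left (norm_nonneg _) (hb 1)
  have : P * G - 1 = -(b 1 * x) * (b 1 * x) + r * (1 - b 1 * x) + g * (1 + b 1 * x) + r * g := by
    rw [hr, hg]; ring
  rw [this]
  have e1 : ‖-(b 1 * x) * (b 1 * x)‖ ≤ ‖x‖ * ‖x‖ := by
    rw [norm_mul, norm_neg]; gcongr
  have e2 : ‖r * (1 - b 1 * x)‖ ≤ 5/2 * ‖x‖ ^ 2 * 2 := by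
    rw [norm_mul]; gcongr
    refine (norm_sub_le _ _).trans ?_
    simp only [norm_one]; linarith
  have e3 : ‖g * (1 + b 1 * x)‖ ≤ 30 * ‖x‖ ^ 2 * 2 := by
    rw [norm_mul]; gcongr
    refine (norm_add_le _ _).trans ?_
    simp only [norm_one]; linarith
  have e4 : ‖r * g‖ ≤ 5/2 * ‖x‖ ^ 2 * (30 * ‖x‖ ^ 2) := by
    rw [norm_mul]; gcongr
  have e5 : ‖x‖ ^ 2 ≤ 9/25 := by nlinarith [norm_nonneg x]
  have e6 : 5/2 * ‖x‖ ^ 2 * (30 * ‖x‖ ^ 2) ≤ 27 * ‖x‖ ^ 2 := by nlinarith [sq_nonneg ‖x‖]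
  refine (norm_add₄_le).trans ?_
  nlinarith [sq_nonneg ‖x‖]

/-- multiplicative coefficient data -/
structure Dat (a : ℕ → ℂ) (z : ℂ) : Prop where
  one : a 1 = 1
  mul : ∀ m n : ℕ, Nat.Coprime m n → a (m * n) = a m * a n
  bd : ∀ n, ‖a n‖ ≤ 1
  prime : ∀ q : ℕ, q.Prime → a q = z
  zero : a 0 = 0

lemma Dat.norm_z {a : ℕ → ℂ} {z : ℂ} (h : Dat a z) : ‖z‖ ≤ 1 := by
  rw [← h.prime 2 Nat.prime_two]; exact h.bd 2

noncomputable def uF (a : ℕ → ℂ) (z : ℂ) (q : Nat.Primes) (s : ℂ) : ℂ :=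
  (∑' e, a (q ^ e) * (((q : ℕ) : ℂ) ^ (-s)) ^ e) * exp (z * log (1 - ((q : ℕ) : ℂ) ^ (-s))) - 1

lemma norm_q {q : Nat.Primes} {s : ℂ} : ‖((q : ℕ) : ℂ) ^ (-s)‖ = ((q : ℕ) : ℝ) ^ (-s.re) := by
  rw [norm_natCast_cpow_of_pos q.2.pos]; simp

lemma norm_q_le {q : Nat.Primes} {s : ℂ} (hs : 3/4 ≤ s.re) : ‖((q : ℕ) : ℂ) ^ (-s)‖ ≤ ((q : ℕ) : ℝ) ^ (-(3/4:ℝ)) := by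
  rw [norm_q]
  apply Real.rpow_le_rpow_of_exponent_le
  · exact_mod_cast q.2.one_lt.le
  · linarith

lemma norm_q_le' {q : Nat.Primes} {s : ℂ} (hs : 3/4 ≤ s.re) : ‖((q : ℕ) : ℂ) ^ (-s)‖ ≤ 3/5 := by
  refine (norm_q_le hs).trans ?_
  have : ((q : ℕ) : ℝ) ^ (-(3/4:ℝ)) ≤ (2:ℝ) ^ (-(3/4:ℝ)) := by
    apply Real.rpow_le_rpow_of_nonpos (by norm_num)
    · exact_mod_cast q.2.two_le
    · norm_num
  refine this.trans ?_
  have h1 : ((2:ℝ) ^ (-(3/4:ℝ))) ^ 4 = 1/8 := by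
    rw [← Real.rpow_natCast, ← Real.rpow_mul (by norm_num)]
    norm_num
  refine le_of_pow_le_pow_left₀ (n := 4) (by norm_num) (by norm_num) ?_
  rw [h1]; norm_num

lemma uF_bound {a : ℕ → ℂ} {z : ℂ} (h : Dat a z) (q : Nat.Primes) {s : ℂ} (hs : 3/4 ≤ s.re) :
    ‖uF a z q s‖ ≤ 100 * ((q : ℕ) : ℝ) ^ (-(3/2:ℝ)) := by
  have := local_factor (b := fun e => a (q ^ e)) (fun e => h.bd _) (by simp [h.one]) (norm_q_le' (q := q) hs)
  simp only [pow_one, h.prime q q.2] at this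
  refine this.trans ?_
  gcongr
  refine (pow_le_pow_left₀ (norm_nonneg _) (norm_q_le hs) 2).trans (le_of_eq ?_)
  rw [← Real.rpow_natCast, ← Real.rpow_mul (by positivity)]
  norm_num

lemma uF_summable : Summable (fun q : Nat.Primes => 100 * ((q : ℕ) : ℝ) ^ (-(3/2:ℝ))) :=
  (Nat.Primes.summable_rpow.2 (by norm_num)).mul_left _

lemma uF_diff {a : ℕ → ℂ} {z : ℂ} (h : Dat a z) (q : Nat.Primes) :
    DifferentiableOn ℂ (uF a z q) {s : ℂ | 3/4 < s.re} := by
  have hq0 : ((q : ℕ) : ℂ) ≠ 0 := by exact_mod_cast q.2.ne_zero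
  have hx : Differentiable ℂ (fun s : ℂ => ((q : ℕ) : ℂ) ^ (-s)) :=
    fun s => DifferentiableAt.const_cpow differentiableAt_id.neg (Or.inl hq0)
  have h1 : DifferentiableOn ℂ (fun s : ℂ => ∑' e, a (q ^ e) * (((q : ℕ) : ℂ) ^ (-s)) ^ e) {s : ℂ | 3/4 < s.re} := by
    refine differentiableOn_tsum_of_summable_norm
      (summable_geometric_of_lt_one (r := 3/5) (by norm_num) (by norm_num)) (fun e => ?_) isOpen_34 ?_
    · exact ((hx.pow e).const_mul _).differentiableOn
    · intro e s hs
      rw [norm_mul, norm_pow]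
      refine (mul_le_of_le_one_left (by positivity) (h.bd _)).trans ?_
      exact pow_le_pow_left₀ (norm_nonneg _) (norm_q_le' (le_of_lt hs)) e
  have h2 : DifferentiableOn ℂ (fun s : ℂ => exp (z * log (1 - ((q : ℕ) : ℂ) ^ (-s)))) {s : ℂ | 3/4 < s.re} := by
    intro s hs
    apply DifferentiableAt.differentiableWithinAt
    apply DifferentiableAt.cexp
    apply DifferentiableAt.const_mul
    apply DifferentiableAt.clog
    · exact (differentiableAt_const _).sub (hx s)
    · left
      have := norm_q_le' (q := q) (le_of_lt hs)
      have h3 := (Complex.re_le_norm (((q : ℕ) : ℂ) ^ (-s)))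
      simp only [sub_re, one_re]
      linarith
  exact (h1.mul h2).sub_const 1

noncomputable def FT (a : ℕ → ℂ) (z : ℂ) (s : ℂ) : ℂ := ∏' q : Nat.Primes, (1 + uF a z q s)

lemma FT_hasProd {a : ℕ → ℂ} {z : ℂ} (h : Dat a z) :
    HasProdLocallyUniformlyOn (fun q s => 1 + uF a z q s) (FT a z) {s : ℂ | 3/4 < s.re} :=
  Summable.hasProdLocallyUniformlyOn_one_add isOpen_34 uF_summable
    (Eventually.of_forall fun q s hs => uF_bound h q (le_of_lt hs)) fun q => (uF_diff h q).continuousOn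

lemma FT_BigG {a : ℕ → ℂ} {z : ℂ} (h : Dat a z) : BigG (FT a z) := by
  refine ⟨?_, fun δ hδ => ⟨1/8, by norm_num, by norm_num, Real.exp (∑' q : Nat.Primes, 100 * ((q : ℕ) : ℝ) ^ (-(3/2:ℝ))), ?_, ?_⟩⟩
  · have := hasProdLocallyUniformlyOn_iff_tendstoLocallyUniformlyOn.1 (FT_hasProd h)
    refine this.differentiableOn (Eventually.of_forall fun S => ?_) isOpen_34
    exact DifferentiableOn.fun_finsetProd fun q _ => (uF_diff h q).const_add 1
  · apply Real.one_le_exp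
    exact tsum_nonneg fun q => by positivity
  · intro s hs1 hs2
    have hs : s ∈ {s : ℂ | 3/4 < s.re} := by simp only [mem_ofPred_eq]; linarith
    have h1 := (FT_hasProd h).hasProd hs
    have hle : ‖FT a z s‖ ≤ Real.exp (∑' q : Nat.Primes, 100 * ((q : ℕ) : ℝ) ^ (-(3/2:ℝ))) := by
      refine le_of_tendsto (Filter.Tendsto.norm h1) (Eventually.of_forall fun S => ?_)
      rw [norm_prod]
      calc ∏ q ∈ S, ‖1 + uF a z q s‖ ≤ ∏ q ∈ S, (1 + 100 * ((q : ℕ) : ℝ) ^ (-(3/2:ℝ))) := by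
            apply Finset.prod_le_prod
            · intros; positivity
            · intro q _
              refine (norm_add_le _ _).trans ?_
              simp only [norm_one]
              linarith [uF_bound h q (le_of_lt hs)]
        _ ≤ Real.exp (∑ q ∈ S, 100 * ((q : ℕ) : ℝ) ^ (-(3/2:ℝ))) :=
            Real.prod_one_add_le_exp_sum S fun q => by positivity
        _ ≤ _ := Real.exp_le_exp.2 (uF_summable.sum_le_tsum S fun q _ => by positivity)
    refine hle.trans ?_
    have : (1:ℝ) ≤ (1 + |s.im|) ^ δ := Real.one_le_rpow (by linarith [abs_nonneg s.im]) hδ.le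
    exact le_mul_of_one_le_right (Real.exp_pos _).le this

lemma log_q_summable {s : ℂ} (hs : 1 < s.re) :
    Summable (fun q : Nat.Primes => log (1 - ((q : ℕ) : ℂ) ^ (-s))) := by
  refine Summable.of_norm_bounded (g := fun q : Nat.Primes => 2 * ((q : ℕ) : ℝ) ^ (-s.re))
    ((Nat.Primes.summable_rpow.2 (by linarith)).mul_left 2) fun q => ?_
  have hx := norm_q_le' (q := q) (s := s) (by linarith)
  rw [← norm_q]
  set x := ((q : ℕ) : ℂ) ^ (-s)
  have h1 := norm_log_one_add_le (z := -x) (by rw [norm_neg]; linarith)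
  rw [norm_neg, ← sub_eq_add_neg] at h1
  refine h1.trans ?_
  have hinv : (1 - ‖x‖)⁻¹ ≤ 5/2 := by
    rw [inv_le_comm₀ (by linarith) (by norm_num)]
    linarith
  have h3 : ‖x‖ ^ 2 * (1 - ‖x‖)⁻¹ ≤ ‖x‖ ^ 2 * (5/2) := by gcongr
  nlinarith [norm_nonneg x]

lemma LZ_eq_tsum {s : ℂ} (hs : 1 < s.re) : ∑' q : Nat.Primes, -log (1 - ((q : ℕ) : ℂ) ^ (-s)) = LZ s := by
  have := DirichletCharacter.eulerProduct_log_eq_LSeries (1 : DirichletCharacter ℂ 1) hs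
  simpa [MulChar.one_apply <| isUnit_of_subsingleton _, LZ] using this

lemma a_summable {a : ℕ → ℂ} (hb : ∀ n, ‖a n‖ ≤ 1) {s : ℂ} (hs : 1 < s.re) : LSeriesSummable a s :=
  LSeriesSummable_of_bounded_of_one_lt_re (m := 1) (fun n _ => hb n) hs

lemma D_eq {a : ℕ → ℂ} {z : ℂ} (h : Dat a z) {s : ℂ} (hs : 1 < s.re) :
    LSeries a s = ZZ z s * FT a z s := by
  have hs' : s ∈ {s : ℂ | 3/4 < s.re} := by simp only [mem_ofPred_eq]; linarith
  have h1 := (FT_hasProd h).hasProd hs'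
  have hsum := a_summable h.bd hs
  have h2 : HasProd (fun q : Nat.Primes => ∑' e, LSeries.term a s (q ^ e)) (LSeries a s) := by
    refine EulerProduct.eulerProduct_hasProd (f := LSeries.term a s) ?_ ?_ hsum.norm (by simp)
    · simp [LSeries.term, h.one]
    · intro m n hmn
      rcases eq_or_ne m 0 with rfl | hm
      · simp
      rcases eq_or_ne n 0 with rfl | hn
      · simp
      rw [LSeries.term_of_ne_zero hm, LSeries.term_of_ne_zero hn, LSeries.term_of_ne_zero (mul_ne_zero hm hn),
        h.mul m n hmn]
      push_cast
      rw [natCast_mul_natCast_cpow]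
      ring
  have h3 : HasProd (fun q : Nat.Primes => exp (z * log (1 - ((q : ℕ) : ℂ) ^ (-s)))) (exp (-(z * LZ s))) := by
    have := ((log_q_summable hs).hasSum.mul_left z).cexp
    have e1 : z * ∑' (b : Nat.Primes), log (1 - ((b : ℕ) : ℂ) ^ (-s)) = -(z * LZ s) := by
      rw [← LZ_eq_tsum hs, tsum_neg]
      ring
    rw [e1] at this
    exact this
  have h4 := h2.mul h3
  have h5 : HasProd (fun q : Nat.Primes => 1 + uF a z q s) (LSeries a s * exp (-(z * LZ s))) := by
    convert h4 using 2 with q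
    simp only [uF, add_sub_cancel]
    congr 2
    ext e
    have hq : (q : ℕ) ^ e ≠ 0 := pow_ne_zero _ q.2.ne_zero
    rw [LSeries.term_of_ne_zero hq, div_eq_mul_inv, ← cpow_neg]
    congr 1
    push_cast
    exact (cpow_nat_mul _ e _).symm.trans (natCast_cpow_natCast_mul _ _ _)
  have h6 := h1.unique h5
  rw [h6, ZZ, mul_comm, mul_assoc, ← exp_add]
  simp

lemma LZ_series {s : ℂ} (hs : 1 < s.re) :
   ∑' (q : Nat.Primes) (m : ℕ), 1 / ((m + 1) * ((q : ℕ) : ℂ) ^ (((m : ℂ) + 1) * s)) = LZ s := by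
  rw [← LZ_eq_tsum hs]
  congr 1
  ext q
  have hx := norm_q_le' (q := q) (s := s) (by linarith)
  rw [← (hasSum_taylorSeries_neg_log' (z := ((q : ℕ) : ℂ) ^ (-s)) (by linarith)).tsum_eq]
  congr 1
  ext m
  rw [← cpow_nat_mul, div_eq_mul_inv, mul_inv, ← cpow_neg, div_eq_mul_inv]
  push_cast
  rw [one_mul, mul_comm, mul_neg]
end

section
open Complex Set Filter Topology Metric

lemma LZ_real_im {x : ℝ} (hx : 1 < x) : (LZ x).im = 0 := by
  have hs' : 1 < ((x : ℝ) : ℂ).re := by simpa using hx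
  have h1 : HasSum (fun n => LSeries.term (fun (n : ℕ) ↦ (ArithmeticFunction.vonMangoldt n : ℂ) / Real.log n) (x : ℂ) n)
    (LZ (x : ℂ)) := (LZ_summable hs').hasSum
  have h2 := Complex.hasSum_im h1
  have h3 : ∀ n : ℕ, (LSeries.term (fun (n : ℕ) ↦ (ArithmeticFunction.vonMangoldt n : ℂ) / Real.log n) (x : ℂ) n).im = 0 := by
    intro n
    rcases eq_or_ne n 0 with rfl | hn
    · simp
    rw [LSeries.term_of_ne_zero hn]
    have : ((n : ℂ) ^ (x : ℂ)) = (((n : ℝ) ^ x : ℝ) : ℂ) := by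
      rw [Complex.ofReal_cpow (by positivity)]; simp
    rw [this]
    norm_cast
  simp only [h3] at h2
  exact h2.unique hasSum_zero

def WW (r : ℝ) : Set ℂ := ball 1 r ∩ HP

lemma isOpen_WW (r : ℝ) : IsOpen (WW r) := isOpen_ball.inter isOpen_HP

lemma sub_one_slit {s : ℂ} (hs : s ∈ HP) : s - 1 ∈ slitPlane := by
  left; simp only [sub_re, one_re]; have : 1 < s.re := hs; linarith

lemma LZ_local : ∃ r : ℝ, 0 < r ∧ r < 1/4 ∧ (∀ s ∈ ball (1:ℂ) r, riemannZeta₁ s ∈ slitPlane) ∧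
    ∀ s ∈ WW r, LZ s = -log (s - 1) + log (riemannZeta₁ s) := by
  have hc : ContinuousAt riemannZeta₁ 1 := differentiable_riemannZeta₁.continuous.continuousAt
  have hev : ∀ᶠ s in 𝓝 (1:ℂ), riemannZeta₁ s ∈ slitPlane := by
    apply hc.eventually_mem
    rw [riemannZeta₁_one]
    exact isOpen_slitPlane.mem_nhds one_mem_slitPlane
  obtain ⟨r0, hr0, hb⟩ := Metric.eventually_nhds_iff_ball.1 hev
  set r := min r0 (1/8) with hr
  have hr0' : 0 < r := by positivity
  have hr8 : r ≤ 1/8 := min_le_right _ _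
  have hb' : ∀ s ∈ ball (1:ℂ) r, riemannZeta₁ s ∈ slitPlane := fun s hs =>
    hb s (ball_subset_ball (min_le_left _ _) hs)
  refine ⟨r, hr0', by linarith, hb', ?_⟩
  set d : ℂ → ℂ := fun s => LZ s + log (s - 1) - log (riemannZeta₁ s) with hd
  have hdd : DifferentiableOn ℂ d (WW r) := by
    intro s hs
    apply DifferentiableAt.differentiableWithinAt
    refine ((LZ_diff.differentiableAt (isOpen_HP.mem_nhds hs.2)).fun_add ?_).fun_sub ?_
    · exact (differentiableAt_id.sub_const 1).clog (sub_one_slit hs.2)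
    · exact (differentiable_riemannZeta₁ s).clog (hb' s hs.1)
  have hexp : ∀ s ∈ WW r, exp (d s) = 1 := by
    intro s hs
    have h1 : s - 1 ≠ 0 := slitPlane_ne_zero (sub_one_slit hs.2)
    have h2 := slitPlane_ne_zero (hb' s hs.1)
    simp only [hd]
    rw [exp_sub, exp_add, exp_LZ hs.2, exp_log h1, exp_log h2, riemannZeta_eq_inv_sub_mul (HP_ne_one hs.2)]
    field_simp
  have hder : (WW r).EqOn (deriv d) 0 := by
    intro s hs
    have h1 := (hdd.differentiableAt ((isOpen_WW r).mem_nhds hs)).hasDerivAt.cexp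
    have h2 : deriv (fun s => exp (d s)) s = 0 := by
      have : (fun s => exp (d s)) =ᶠ[𝓝 s] fun _ => 1 := by
        filter_upwards [(isOpen_WW r).mem_nhds hs] with w hw using hexp w hw
      rw [this.deriv_eq]; simp
    rw [h1.deriv, hexp s hs, one_mul] at h2
    exact h2
  have hpre : IsPreconnected (WW r) := by
    apply Convex.isPreconnected
    exact (convex_ball _ _).inter (convex_halfSpace_re_gt 1)
  have hpt : ((1 + r / 2 : ℝ) : ℂ) ∈ WW r := by
    constructor
    · rw [mem_ball, dist_eq_norm]; push_cast; simp [abs_of_pos hr0']; linarith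
    · simp only [HP, mem_ofPred_eq, ofReal_re]; linarith
  have hz0 : d ((1 + r / 2 : ℝ) : ℂ) = 0 := by
    have him : (d ((1 + r / 2 : ℝ) : ℂ)).im = 0 := by
      have e1 := LZ_real_im (x := 1 + r / 2) (by linarith)
      have e2 : (log ((1 + r / 2 : ℝ) - 1)).im = 0 := by
        rw [show (((1 + r / 2 : ℝ) : ℂ) - 1) = ((r / 2 : ℝ) : ℂ) by push_cast; ring, ← ofReal_log (by positivity), ofReal_im]
      have e3 : (log (riemannZeta₁ (1 + r / 2 : ℝ))).im = 0 := by
        have h1 : riemannZeta₁ (1 + r / 2 : ℝ) = ((r / 2 * Real.exp ((LZ (1 + r / 2 : ℝ)).re) : ℝ) : ℂ) := by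
          have h2 := riemannZeta_eq_inv_sub_mul (HP_ne_one hpt.2)
          have h3 : LZ ((1 + r / 2 : ℝ) : ℂ) = ((LZ ((1 + r / 2 : ℝ) : ℂ)).re : ℂ) := by
            apply Complex.ext
            · simp
            · rw [e1]; simp
          push_cast
          push_cast at h3 h2
          rw [← h3, exp_LZ (by simp; linarith), h2]
          have : (r : ℂ) ≠ 0 := by exact_mod_cast hr0'.ne'
          rw [show (1 + (r:ℂ) / 2 - 1) = (r:ℂ)/2 by ring, ← mul_assoc, mul_inv_cancel₀ (by simpa using this), one_mul]
        rw [h1, ← ofReal_log (by positivity), ofReal_im]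
      simp only [hd, sub_im, add_im]
      rw [e1, e2, e3]; ring
    have hee := hexp _ hpt
    have hre : d ((1 + r / 2 : ℝ) : ℂ) = ((d ((1 + r / 2 : ℝ) : ℂ)).re : ℂ) := by
      apply Complex.ext
      · simp
      · rw [him]; simp
    rw [hre] at hee ⊢
    have : Real.exp (d ((1 + r / 2 : ℝ) : ℂ)).re = 1 := by exact_mod_cast hee
    rw [Real.exp_eq_one_iff] at this
    exact_mod_cast this
  intro s hs
  have := (isOpen_WW r).is_const_of_deriv_eq_zero hpre hdd hder hs hpt
  rw [hz0] at this
  simp only [hd] at this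
  linear_combination this

lemma D_local {a : ℕ → ℂ} {z : ℂ} (h : Dat a z) : ∃ r : ℝ, 0 < r ∧ r < 1/4 ∧ ∃ G : ℂ → ℂ,
    DifferentiableOn ℂ G (ball 1 r) ∧ G 1 = FT a z 1 ∧ ∀ s ∈ WW r, LSeries a s = (s - 1) ^ (-z) * G s := by
  obtain ⟨r, h0, h1, h2, h3⟩ := LZ_local
  refine ⟨r, h0, h1, fun s => exp (z * log (riemannZeta₁ s)) * FT a z s, ?_, ?_, ?_⟩
  · refine DifferentiableOn.mul ?_ ?_
    · intro s hs
      exact (((differentiable_riemannZeta₁ s).clog (h2 s hs)).const_mul z).cexp.differentiableWithinAt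
    · refine (FT_BigG h).1.mono fun s hs => ?_
      rw [mem_ball, dist_eq_norm] at hs
      have := (abs_re_le_norm (s - 1)).trans_lt hs
      rw [abs_lt] at this
      simp only [sub_re, one_re] at this
      simp only [mem_ofPred_eq]; linarith [this.1]
  · simp [riemannZeta₁_one]
  · intro s hs
    rw [D_eq h hs.2, ZZ, h3 s hs, cpow_def_of_ne_zero (slitPlane_ne_zero (sub_one_slit hs.2)), ← mul_assoc, ← exp_add]
    ring_nf

lemma iter_local {r : ℝ} (hr : 0 < r) (k : ℕ) : ∀ (α : ℂ) (G f : ℂ → ℂ), DifferentiableOn ℂ G (ball 1 r) →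
    (∀ s ∈ WW r, f s = (s - 1) ^ α * G s) →
    ∃ H : ℂ → ℂ, DifferentiableOn ℂ H (ball 1 r) ∧ H 1 = (∏ i ∈ Finset.range k, (α - i)) * G 1 ∧
      ∀ s ∈ WW r, iteratedDeriv k f s = (s - 1) ^ (α - k) * H s := by
  induction k with
  | zero => intro α G f hG hf; exact ⟨G, hG, by simp, by simpa using hf⟩
  | succ k ih =>
    intro α G f hG hf
    have hA : DifferentiableOn ℂ (fun s => α * G s + (s - 1) * deriv G s) (ball 1 r) :=
      (hG.const_mul α).fun_add ((differentiableOn_id.sub_const 1).fun_mul (hG.deriv isOpen_ball))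
    have hB : ∀ s ∈ WW r, deriv f s = (s - 1) ^ (α - 1) * (α * G s + (s - 1) * deriv G s) := by
      intro s hs
      have e1 : deriv f s = deriv (fun s => (s - 1) ^ α * G s) s := by
        apply Filter.EventuallyEq.deriv_eq
        filter_upwards [(isOpen_WW r).mem_nhds hs] with w hw using hf w hw
      have e2 := (((hasDerivAt_id s).sub_const 1).cpow_const (c := α) (sub_one_slit hs.2)).fun_mul
        (hG.differentiableAt (isOpen_ball.mem_nhds hs.1)).hasDerivAt
      have hne := slitPlane_ne_zero (sub_one_slit hs.2)
      rw [e1]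
      refine e2.deriv.trans ?_
      simp only [id]
      have : (s - 1) ^ α = (s - 1) ^ (α - 1) * (s - 1) := by
        rw [cpow_sub _ _ hne, cpow_one]; field_simp
      rw [this]; ring
    obtain ⟨H, h1, h2, h3⟩ := ih (α - 1) (fun s => α * G s + (s - 1) * deriv G s) (deriv f) hA hB
    refine ⟨H, h1, ?_, ?_⟩
    · rw [h2, Finset.prod_range_succ']
      have : ∏ i ∈ Finset.range k, (α - 1 - i) = ∏ i ∈ Finset.range k, (α - ((i + 1 : ℕ) : ℂ)) := by
        apply Finset.prod_congr rfl; intro i _; push_cast; ring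
      rw [this]; push_cast; ring
    · intro s hs
      rw [iteratedDeriv_succ', h3 s hs]
      congr 2; push_cast; ring

lemma taylor_local {r : ℝ} (hr : 0 < r) (J : ℕ) : ∀ (H : ℂ → ℂ), DifferentiableOn ℂ H (ball 1 r) →
    ∃ (h : ℕ → ℂ) (K : ℂ → ℂ), h 0 = H 1 ∧ DifferentiableOn ℂ K (ball 1 r) ∧
      ∀ s, H s = ∑ j ∈ Finset.range J, h j * (s - 1) ^ j + (s - 1) ^ J * K s := by
  induction J with
  | zero => intro H hH; exact ⟨fun _ => H 1, H, rfl, hH, by simp⟩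
  | succ J ih =>
    intro H hH
    obtain ⟨h, K, h0, h1, h2⟩ := ih (dslope H 1) ((differentiableOn_dslope (isOpen_ball.mem_nhds (mem_ball_self hr))).2 hH)
    refine ⟨fun j => if j = 0 then H 1 else h (j - 1), K, by simp, h1, fun s => ?_⟩
    have h3 : H s = H 1 + (s - 1) * dslope H 1 s := by
      have := sub_smul_dslope H 1 s
      rw [smul_eq_mul] at this
      rw [this]; ring
    rw [Finset.sum_range_succ', h3, h2 s]
    simp only [Nat.add_eq_zero_iff, one_ne_zero, and_false, if_false, Nat.add_sub_cancel, if_true, pow_zero, mul_one]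
    rw [mul_add, Finset.mul_sum]
    have : ∀ j, (s - 1) * (h j * (s - 1) ^ j) = h j * (s - 1) ^ (j + 1) := fun j => by ring
    simp only [this]
    ring

lemma norm_cpow_le' {s : ℂ} (hs : s ∈ HP) (w : ℂ) : ‖(s - 1) ^ w‖ ≤ Real.exp (Real.pi * |w.im|) * ‖s - 1‖ ^ w.re := by
  rw [norm_cpow_of_ne_zero (slitPlane_ne_zero (sub_one_slit hs)), div_eq_mul_inv, mul_comm, ← Real.exp_neg]
  gcongr
  have := abs_arg_le_pi (s - 1)
  calc -(arg (s - 1) * w.im) ≤ |arg (s - 1) * w.im| := neg_le_abs _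
    _ = |arg (s - 1)| * |w.im| := abs_mul _ _
    _ ≤ _ := by gcongr

lemma D_SC {a : ℕ → ℂ} {z : ℂ} (h : Dat a z) {τ : ℝ} (hτ : 0 < τ) (n : ℕ) : SC τ n (LSeries a) :=
  ((ZZ_SC hτ h.norm_z n).mul ((FT_BigG h).SC τ n)).congr fun _ hs => (D_eq h hs).symm

/-- the remainder -/
noncomputable def RR (a : ℕ → ℂ) (z : ℂ) (k : ℕ) (h : ℕ → ℂ) (s : ℂ) : ℂ :=
  (-1) ^ k * iteratedDeriv k (LSeries a) s - ∑ j ∈ Finset.range (k - 1), h j * (s - 1) ^ ((j : ℂ) - z - k)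

lemma iterD_diff {f : ℂ → ℂ} (hf : DifferentiableOn ℂ f HP) (k : ℕ) : DifferentiableOn ℂ (iteratedDeriv k f) HP := by
  induction k with
  | zero => simpa using hf
  | succ k ih => rw [iteratedDeriv_succ]; exact ih.deriv isOpen_HP

lemma RR_diff {a : ℕ → ℂ} {z : ℂ} (h : Dat a z) (k : ℕ) (c : ℕ → ℂ) : DifferentiableOn ℂ (RR a z k c) HP := by
  refine ((iterD_diff (D_SC h one_pos 0).diff k).const_mul _).sub ?_
  refine DifferentiableOn.fun_sum fun j _ => ?_
  intro s hs
  exact (((differentiableAt_id.sub_const 1).cpow_const (sub_one_slit hs)).const_mul _).differentiableWithinAt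

theorem RR_bound {a : ℕ → ℂ} {z : ℂ} (h : Dat a z) {k : ℕ} (hk : 2 ≤ k) :
    ∃ c : ℕ → ℂ, c 0 = (∏ i ∈ Finset.range k, (z + i)) * FT a z 1 ∧ ∃ C : ℝ, 0 < C ∧
      ∀ s : ℂ, 1 < s.re → s.re ≤ 2 → ‖RR a z k c s‖ ≤ C * ((s.re - 1)⁻¹) ^ 2 * (1 + |s.im|) ^ (1/2 : ℝ) := by
  obtain ⟨r, hr0, hr1, G, hG, hG1, hGe⟩ := D_local h
  obtain ⟨H, hH, hH1, hHe⟩ := iter_local hr0 k (-z) G (LSeries a) hG hGe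
  obtain ⟨c, K, hc0, hK, hKe⟩ := taylor_local hr0 (k - 1) (fun s => (-1) ^ k * H s) (hH.const_mul _)
  refine ⟨c, ?_, ?_⟩
  · rw [hc0, hH1, hG1, ← mul_assoc]
    congr 1
    have : ∏ i ∈ Finset.range k, (-z - i) = ∏ i ∈ Finset.range k, (-1) * (z + i) :=
      Finset.prod_congr rfl fun i _ => by ring
    rw [this, Finset.prod_mul_distrib, Finset.prod_const, Finset.card_range, ← mul_assoc, ← mul_pow]
    simp
  have hzre : |z.re| ≤ 1 := (abs_re_le_norm z).trans h.norm_z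
  have hzre' := abs_le.1 hzre
  have hzim : |z.im| ≤ 1 := (abs_im_le_norm z).trans h.norm_z
  have hlow : ∀ s : ℂ, 1 < s.re → s.re ≤ 2 → 1 ≤ ((s.re - 1)⁻¹) ^ 2 * (1 + |s.im|) ^ (1/2 : ℝ) := by
    intro s h1 h2
    have e1 : 1 ≤ (s.re - 1)⁻¹ := (one_le_inv₀ (by linarith)).2 (by linarith)
    have e2 : 1 ≤ (1 + |s.im|) ^ (1/2 : ℝ) := Real.one_le_rpow (by linarith [abs_nonneg s.im]) (by norm_num)
    have e3 : 1 ≤ ((s.re - 1)⁻¹) ^ 2 := one_le_pow₀ e1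
    nlinarith
  -- near
  have hnear : ∃ C1 : ℝ, 0 < C1 ∧ ∀ s : ℂ, 1 < s.re → s.re ≤ 2 → ‖s - 1‖ ≤ r / 2 →
      ‖RR a z k c s‖ ≤ C1 * (((s.re - 1)⁻¹) ^ 2 * (1 + |s.im|) ^ (1/2 : ℝ)) := by
    have hcomp : IsCompact (closedBall (1:ℂ) (r/2)) := isCompact_closedBall _ _
    have hsub : closedBall (1:ℂ) (r/2) ⊆ ball 1 r := closedBall_subset_ball (by linarith)
    obtain ⟨B, hB⟩ := hcomp.exists_bound_of_continuousOn (hK.continuousOn.mono hsub)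
    refine ⟨Real.exp Real.pi * (|B| + 1), by positivity, fun s h1 h2 h3 => ?_⟩
    have hsHP : s ∈ HP := h1
    have hmem : s ∈ closedBall (1:ℂ) (r/2) := by rw [mem_closedBall, dist_eq_norm]; exact h3
    have hW : s ∈ WW r := ⟨hsub hmem, hsHP⟩
    have hne := slitPlane_ne_zero (sub_one_slit hsHP)
    have heq : RR a z k c s = (s - 1) ^ (-1 - z) * K s := by
      rw [RR, hHe s hW]
      have e1 : (-1) ^ k * ((s - 1) ^ (-z - k) * H s) = (s - 1) ^ (-z - k) * ((-1) ^ k * H s) := by ring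
      rw [e1, hKe s, mul_add, Finset.mul_sum]
      have e2 : ∀ j ∈ Finset.range (k - 1), (s - 1) ^ (-z - k) * (c j * (s - 1) ^ j) = c j * (s - 1) ^ ((j : ℂ) - z - k) := by
        intro j _
        rw [show ((j : ℂ) - z - k) = (-z - k) + j by ring, cpow_add _ _ hne, cpow_natCast]; ring
      rw [Finset.sum_congr rfl e2, add_sub_cancel_left, ← mul_assoc]
      congr 1
      rw [← cpow_natCast, ← cpow_add _ _ hne]
      congr 1
      rw [Nat.cast_sub (by omega)]; push_cast; ring
    rw [heq, norm_mul]
    have hnp : 0 < ‖s - 1‖ := norm_pos_iff.2 hne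
    have e3 : ‖(s - 1) ^ (-1 - z)‖ ≤ Real.exp Real.pi * ((s.re - 1)⁻¹) ^ 2 := by
      refine (norm_cpow_le' hsHP _).trans ?_
      have : (-1 - z).im = - z.im := by simp
      rw [this, abs_neg]
      gcongr
      · nlinarith [Real.pi_pos]
      · have e4 : ‖s - 1‖ ^ (-1 - z).re ≤ ‖s - 1‖ ^ (-2 : ℝ) := by
          apply Real.rpow_le_rpow_of_exponent_ge hnp (by linarith)
          simp; linarith [hzre'.2]
        refine e4.trans ?_
        rw [Real.rpow_neg hnp.le, inv_pow]
        norm_cast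
        have e5 : s.re - 1 ≤ ‖s - 1‖ := by have := re_le_norm (s - 1); simpa using this
        have e6 : 0 < s.re - 1 := by linarith
        gcongr
    have e7 : ‖K s‖ ≤ |B| + 1 := (hB s hmem).trans (by linarith [le_abs_self B])
    have e2 : 1 ≤ (1 + |s.im|) ^ (1/2 : ℝ) := Real.one_le_rpow (by linarith [abs_nonneg s.im]) (by norm_num)
    calc ‖(s - 1) ^ (-1 - z)‖ * ‖K s‖ ≤ (Real.exp Real.pi * ((s.re - 1)⁻¹) ^ 2) * (|B| + 1) := by gcongr
      _ = Real.exp Real.pi * (|B| + 1) * (((s.re - 1)⁻¹) ^ 2 * 1) := by ring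
      _ ≤ _ := by gcongr
  -- middle
  have hmid : ∃ C2 : ℝ, 0 < C2 ∧ ∀ s : ℂ, 1 + r / 4 ≤ s.re → s.re ≤ 2 → |s.im| ≤ r / 4 → ‖RR a z k c s‖ ≤ C2 := by
    have hcomp : IsCompact (Icc (1 + r/4) 2 ×ℂ Icc (-(r/4)) (r/4)) := isCompact_Icc.reProdIm isCompact_Icc
    have hsub : (Icc (1 + r/4) 2 ×ℂ Icc (-(r/4)) (r/4)) ⊆ HP := by
      intro s hs
      have := (mem_reProdIm.1 hs).1.1
      simp only [HP, mem_ofPred_eq]; linarith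
    obtain ⟨B, hB⟩ := hcomp.exists_bound_of_continuousOn ((RR_diff h k c).continuousOn.mono hsub)
    exact ⟨|B| + 1, by positivity, fun s h1 h2 h3 => (hB s (mem_reProdIm.2 ⟨⟨h1, h2⟩, abs_le.1 h3⟩)).trans
      (by linarith [le_abs_self B])⟩
  -- far
  have hfar : ∃ C3 : ℝ, 0 < C3 ∧ ∀ s : ℂ, 1 < s.re → s.re ≤ 2 → r / 4 ≤ |s.im| →
      ‖RR a z k c s‖ ≤ C3 * (1 + |s.im|) ^ (1/2 : ℝ) := by
    obtain ⟨C, hC, HC⟩ := (D_SC h (τ := r / 4) (by linarith) k).iteratedDeriv (1/2) (by norm_num)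
    have hterm : ∀ j ∈ Finset.range (k - 1), ∀ s : ℂ, 1 < s.re → r / 4 ≤ |s.im| →
        ‖c j * (s - 1) ^ ((j : ℂ) - z - k)‖ ≤ ‖c j‖ * (Real.exp Real.pi * (r/4) ^ ((j : ℝ) - z.re - k)) := by
      intro j hj s h1 h2
      rw [Finset.mem_range] at hj
      rw [norm_mul]
      gcongr
      refine (norm_cpow_le' h1 _).trans ?_
      have e1 : ((j : ℂ) - z - k).im = - z.im := by simp
      have e2 : ((j : ℂ) - z - k).re = (j : ℝ) - z.re - k := by simp
      rw [e1, e2, abs_neg]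
      apply mul_le_mul _ _ (by positivity) (by positivity)
      · apply Real.exp_le_exp.2; nlinarith [Real.pi_pos]
      · apply Real.rpow_le_rpow_of_nonpos (by linarith)
        · refine h2.trans ?_
          have := abs_im_le_norm (s - 1); simpa using this
        · have : (j : ℝ) + 2 ≤ k := by exact_mod_cast (by omega)
          linarith [hzre'.1]
    refine ⟨C + ∑ j ∈ Finset.range (k - 1), ‖c j‖ * (Real.exp Real.pi * (r/4) ^ ((j : ℝ) - z.re - k)), ?_, fun s h1 h2 h3 => ?_⟩
    · have : 0 ≤ ∑ j ∈ Finset.range (k - 1), ‖c j‖ * (Real.exp Real.pi * (r/4) ^ ((j : ℝ) - z.re - k)) :=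
        Finset.sum_nonneg fun j _ => by positivity
      linarith
    · have e2 : 1 ≤ (1 + |s.im|) ^ (1/2 : ℝ) := Real.one_le_rpow (by linarith [abs_nonneg s.im]) (by norm_num)
      rw [RR]
      refine (norm_sub_le _ _).trans ?_
      rw [add_mul]
      apply add_le_add
      · rw [norm_mul, norm_pow, norm_neg, norm_one, one_pow, one_mul]
        exact HC s h1 h2 h3
      · refine ((norm_sum_le _ _).trans (Finset.sum_le_sum fun j hj => hterm j hj s h1 h3)).trans ?_
        exact le_mul_of_one_le_right (Finset.sum_nonneg fun j _ => by positivity) e2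
  obtain ⟨C1, h1p, H1⟩ := hnear
  obtain ⟨C2, h2p, H2⟩ := hmid
  obtain ⟨C3, h3p, H3⟩ := hfar
  refine ⟨C1 + C2 + C3, by positivity, fun s hs1 hs2 => ?_⟩
  rw [mul_assoc]
  have hl := hlow s hs1 hs2
  set X := ((s.re - 1)⁻¹) ^ 2 * (1 + |s.im|) ^ (1/2 : ℝ) with hX
  rcases le_or_gt (r/4) |s.im| with hA | hA
  · refine (H3 s hs1 hs2 hA).trans ?_
    have e1 : 1 ≤ (s.re - 1)⁻¹ := (one_le_inv₀ (by linarith)).2 (by linarith)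
    have : (1 + |s.im|) ^ (1/2 : ℝ) ≤ X := le_mul_of_one_le_left (by positivity) (one_le_pow₀ e1)
    calc C3 * (1 + |s.im|) ^ (1/2 : ℝ) ≤ C3 * X := by gcongr
      _ ≤ _ := mul_le_mul_of_nonneg_right (by linarith) (by linarith)
  · rcases le_or_gt (1 + r/4) s.re with hB | hB
    · refine (H2 s hB hs2 hA.le).trans ?_
      nlinarith
    · refine (H1 s hs1 hs2 ?_).trans (mul_le_mul_of_nonneg_right (by linarith) (by linarith))
      refine (norm_le_abs_re_add_abs_im _).trans ?_
      simp only [sub_re, one_re, sub_im, one_im, sub_zero]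
      rw [abs_of_pos (by linarith)]
      linarith
end

section
open Complex Set Filter Topology MeasureTheory

lemma cexp_cont (w r : ℂ) : ContinuousOn (fun t : ℝ => (t:ℂ)^w * cexp (-(r*t))) (Ioi 0) := by
  refine ContinuousOn.mul (fun t ht => ?_) (by fun_prop)
  exact (Complex.continuousAt_ofReal_cpow_const _ _ (Or.inr (ne_of_gt ht))).continuousWithinAt

lemma norm_cexp_t {t : ℝ} (ht : 0 < t) (w r : ℂ) :
    ‖(t:ℂ)^w * cexp (-(r*t))‖ = t^w.re * Real.exp (-r.re * t) := by
  rw [norm_mul, Complex.norm_cpow_eq_rpow_re_of_pos ht, Complex.norm_exp]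
  simp

lemma cexp_int (w r : ℂ) (hw : -1 < w.re) (hr : 0 < r.re) :
    IntegrableOn (fun t : ℝ => (t:ℂ)^w * cexp (-(r*t))) (Ioi 0) := by
  have h1 := integrableOn_rpow_mul_exp_neg_mul_rpow (p := 1) hw one_pos hr
  refine Integrable.mono' h1 ((cexp_cont w r).aestronglyMeasurable measurableSet_Ioi) ?_
  filter_upwards [ae_restrict_mem measurableSet_Ioi] with t ht
  rw [norm_cexp_t ht]; simp

lemma cexp_diff (w : ℂ) (hw : -1 < w.re) :
    DifferentiableOn ℂ (fun r : ℂ => ∫ t in Ioi (0:ℝ), (t:ℂ)^w * cexp (-(r*t))) {r : ℂ | 0 < r.re} := by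
  intro r₀ hr₀
  rw [mem_ofPred_eq] at hr₀
  set δ := r₀.re/2 with hδ
  have hδ0 : 0 < δ := by positivity
  refine DifferentiableAt.differentiableWithinAt ?_
  have hre : ∀ r ∈ Metric.ball r₀ δ, δ ≤ r.re := by
    intro r hr
    rw [Metric.mem_ball, dist_eq_norm] at hr
    have := Complex.abs_re_le_norm (r - r₀)
    rw [Complex.sub_re] at this
    have := (abs_le.1 (this.trans hr.le)).1
    linarith
  have := hasDerivAt_integral_of_dominated_loc_of_deriv_le (𝕜 := ℂ) (μ := volume.restrict (Ioi (0:ℝ)))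
    (F := fun r t => (t:ℂ)^w * cexp (-(r*t))) (F' := fun r t => (t:ℂ)^w * (cexp (-(r*t)) * (-t)))
    (x₀ := r₀) (s := Metric.ball r₀ δ) (bound := fun t => t^(w.re+1) * Real.exp (-δ * t^(1:ℝ)))
    (Metric.ball_mem_nhds _ hδ0)
    (Eventually.of_forall fun r => (cexp_cont w r).aestronglyMeasurable measurableSet_Ioi)
    (cexp_int w r₀ hw hr₀)
    ?_ ?_ ?_ ?_
  · exact this.2.differentiableAt
  · have : ContinuousOn (fun t : ℝ => ((t:ℂ)^w * cexp (-(r₀*t))) * (-t)) (Ioi 0) :=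
      (cexp_cont w r₀).mul (by fun_prop)
    refine (this.congr fun t _ => ?_).aestronglyMeasurable measurableSet_Ioi
    ring
  · filter_upwards [ae_restrict_mem measurableSet_Ioi] with t ht r hr
    have ht' : 0 < t := ht
    rw [← mul_assoc, norm_mul, norm_cexp_t ht, Real.rpow_add ht', norm_neg, Complex.norm_real,
      Real.norm_of_nonneg ht'.le, Real.rpow_one]
    have : Real.exp (-r.re * t) ≤ Real.exp (-δ * t) := by
      apply Real.exp_le_exp.2
      nlinarith [hre r hr]
    have h2 : 0 ≤ t ^ w.re := by positivity
    calc t^w.re * Real.exp (-r.re*t) * t ≤ t^w.re * Real.exp (-δ*t) * t := by gcongr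
      _ = _ := by ring
  · exact integrableOn_rpow_mul_exp_neg_mul_rpow (by linarith) one_pos hδ0
  · filter_upwards with t r hr
    have : HasDerivAt (fun r : ℂ => -(r*t)) (-t) r := by
      simpa using ((hasDerivAt_id' r).mul_const (t:ℂ)).fun_neg
    exact (this.cexp).const_mul _

lemma gamma_complex (w r : ℂ) (hw : 0 < w.re) (hr : 0 < r.re) :
    ∫ t in Ioi (0:ℝ), (t:ℂ)^(w-1) * cexp (-(r*t)) = Gamma w * r^(-w) := by
  have hU : IsOpen {r : ℂ | 0 < r.re} := isOpen_lt continuous_const Complex.continuous_re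
  have hconv : Convex ℝ {r : ℂ | 0 < r.re} := convex_halfSpace_re_gt 0
  have h1 := (cexp_diff (w-1) (by simp; linarith)).analyticOnNhd hU
  have h2 : DifferentiableOn ℂ (fun r : ℂ => Gamma w * r^(-w)) {r : ℂ | 0 < r.re} := by
    intro r hr
    refine DifferentiableAt.differentiableWithinAt ?_
    refine DifferentiableAt.const_mul ?_ _
    exact (differentiableAt_id.cpow_const (Or.inl hr))
  have h2 := h2.analyticOnNhd hU
  refine h1.eqOn_of_preconnected_of_frequently_eq h2 hconv.isPreconnected (z₀ := 1) (by simp) ?_ hr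
  have hseq : Tendsto (fun n : ℕ => ((1 + 1/((n:ℝ)+1) : ℝ) : ℂ)) atTop (𝓝[≠] 1) := by
    refine tendsto_nhdsWithin_iff.2 ⟨?_, ?_⟩
    · have := (tendsto_one_div_add_atTop_nhds_zero_nat (𝕜 := ℝ)).const_add 1
      have := (Complex.continuous_ofReal.tendsto _).comp this
      simpa [Function.comp_def] using this
    · filter_upwards with n
      simp only [mem_compl_iff, mem_singleton_iff]
      have : (0:ℝ) < 1/((n:ℝ)+1) := by positivity
      rw [← Complex.ofReal_one, Complex.ofReal_inj]
      linarith
  refine hseq.frequently (Eventually.frequently (Eventually.of_forall fun n => ?_))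
  have hp : (0:ℝ) < 1 + 1/((n:ℝ)+1) := by positivity
  rw [integral_cpow_mul_exp_neg_mul_Ioi hw hp, mul_comm, one_div, Complex.inv_cpow, Complex.cpow_neg]
  rw [Complex.arg_ofReal_of_nonneg hp.le]; exact Real.pi_pos.ne

/-- log power integral -/
lemma logpow_int (w s : ℂ) (hw : 0 < w.re) (hs : 1 < s.re) :
    IntegrableOn (fun u : ℝ => ((Real.log u : ℝ) : ℂ)^(w-1) * (u:ℂ)^(-s)) (Ioi 1) ∧
    ∫ u in Ioi (1:ℝ), ((Real.log u : ℝ) : ℂ)^(w-1) * (u:ℂ)^(-s) = Gamma w * (s-1)^(-w) := by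
  have key : ∀ x : ℝ, Real.exp x • (((Real.log (Real.exp x) : ℝ) : ℂ)^(w-1) * ((Real.exp x : ℝ):ℂ)^(-s))
      = (x:ℂ)^(w-1) * cexp (-((s-1)*x)) := by
    intro x
    rw [Real.log_exp, Complex.real_smul, Complex.cpow_def_of_ne_zero (x := ((Real.exp x : ℝ):ℂ)),
      ← Complex.ofReal_log (Real.exp_pos x).le, Real.log_exp, Complex.ofReal_exp]
    · rw [mul_left_comm, ← Complex.exp_add]; ring_nf
    · exact_mod_cast (Real.exp_pos x).ne'
  constructor
  · have := integrableOn_comp_exp_Ioi (fun u : ℝ => ((Real.log u : ℝ) : ℂ)^(w-1) * (u:ℂ)^(-s)) 0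
    rw [Real.exp_zero] at this
    rw [← this]
    simp_rw [key]
    exact cexp_int _ _ (by simp; linarith) (by simp; linarith)
  · have := integral_comp_exp_Ioi (fun u : ℝ => ((Real.log u : ℝ) : ℂ)^(w-1) * (u:ℂ)^(-s)) 0
    rw [Real.exp_zero] at this
    rw [← this]
    simp_rw [key]
    exact gamma_complex _ _ hw (by simp; linarith)

lemma fub (f : ℝ → ℂ) (s : ℂ) (hs : 0 < s.re)
    (hf : IntegrableOn (fun u : ℝ => f u * (u:ℂ)^(-s)) (Ioi 1)) :
    IntegrableOn (fun x : ℝ => (∫ u in (1:ℝ)..x, f u) * (x:ℂ)^(-s-1)) (Ioi 1) ∧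
    s * ∫ x in Ioi (1:ℝ), (∫ u in (1:ℝ)..x, f u) * (x:ℂ)^(-s-1) =
      ∫ u in Ioi (1:ℝ), f u * (u:ℂ)^(-s) := by
  set μ := volume.restrict (Ioi (1:ℝ)) with hμ
  have hs0 : s ≠ 0 := by rintro rfl; simp at hs
  set K : ℝ → ℝ → ℂ := fun x u => f u * (if u ≤ x then (x:ℂ)^(-s-1) else 0) with hK
  have hfm : AEStronglyMeasurable f μ := by
    have h1 : AEStronglyMeasurable (fun u : ℝ => (u:ℂ)^s) μ := by
      refine ContinuousOn.aestronglyMeasurable (fun t ht => ?_) measurableSet_Ioi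
      exact (Complex.continuousAt_ofReal_cpow_const _ _
        (Or.inr (ne_of_gt (zero_lt_one.trans ht)))).continuousWithinAt
    refine (hf.aestronglyMeasurable.mul h1).congr ?_
    filter_upwards [ae_restrict_mem measurableSet_Ioi] with u hu
    have hu0 : (u:ℂ) ≠ 0 := by exact_mod_cast (zero_lt_one.trans hu).ne'
    simp only [Pi.mul_apply]
    rw [mul_assoc, ← Complex.cpow_add _ _ hu0]; simp
  have hKm : AEStronglyMeasurable (Function.uncurry K) (μ.prod μ) := by
    refine (hfm.comp_snd).mul ?_
    refine (Measurable.ite (measurableSet_le measurable_snd measurable_fst) ?_ measurable_const).aestronglyMeasurable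
    fun_prop
  have hKi : ∀ u : ℝ, 1 < u → ∀ x, K x u = (Ici u).indicator (fun x : ℝ => f u * (x:ℂ)^(-s-1)) x := by
    intro u hu x
    by_cases hx : u ≤ x
    · simp [hK, hx]
    · simp [hK, hx]
  have hsub : ∀ u : ℝ, 1 < u → Ici u ∩ Ioi 1 = Ici u := by
    intro u hu; exact inter_eq_left.2 fun x hx => lt_of_lt_of_le hu hx
  have hKin : ∀ u : ℝ, 1 < u → Integrable (fun x => K x u) μ := by
    intro u hu
    simp_rw [hKi u hu]
    rw [integrable_indicator_iff measurableSet_Ici, IntegrableOn, hμ,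
      Measure.restrict_restrict measurableSet_Ici, hsub u hu]
    refine Integrable.const_mul ?_ _
    have := integrableOn_Ioi_cpow_of_lt (a := -s-1) (by simp; linarith) (zero_lt_one.trans hu)
    exact (integrableOn_Ici_iff_integrableOn_Ioi).2 this
  have hK1 : ∀ u : ℝ, 1 < u → ∫ x, K x u ∂μ = s⁻¹ * (f u * (u:ℂ)^(-s)) := by
    intro u hu
    simp_rw [hKi u hu]
    rw [integral_indicator measurableSet_Ici, hμ,
      Measure.restrict_restrict measurableSet_Ici, hsub u hu, integral_Ici_eq_integral_Ioi,
      integral_const_mul, integral_Ioi_cpow_of_lt (by simp; linarith) (zero_lt_one.trans hu)]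
    rw [show -s - 1 + 1 = -s by ring]
    field_simp
  have hK2 : ∀ u : ℝ, 1 < u → ∫ x, ‖K x u‖ ∂μ = s.re⁻¹ * ‖f u * (u:ℂ)^(-s)‖ := by
    intro u hu
    have hu0 := zero_lt_one.trans hu
    have : ∀ x, ‖K x u‖ = (Ici u).indicator (fun x : ℝ => ‖f u‖ * x^(-s.re-1)) x := by
      intro x
      rw [hKi u hu x]
      by_cases hx : u ≤ x
      · rw [indicator_of_mem (show x ∈ Ici u from hx), indicator_of_mem (show x ∈ Ici u from hx),
          norm_mul, Complex.norm_cpow_eq_rpow_re_of_pos (hu0.trans_le hx)]; simp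
      · simp [hx]
    simp_rw [this]
    rw [integral_indicator measurableSet_Ici, hμ,
      Measure.restrict_restrict measurableSet_Ici, hsub u hu, integral_Ici_eq_integral_Ioi,
      integral_const_mul, integral_Ioi_rpow_of_lt (by linarith) hu0, norm_mul,
      Complex.norm_cpow_eq_rpow_re_of_pos hu0]
    rw [show -s.re - 1 + 1 = -s.re by ring, Complex.neg_re]
    field_simp
  have hIntg : Integrable (Function.uncurry K) (μ.prod μ) := by
    rw [integrable_prod_iff' hKm]
    constructor
    · filter_upwards [ae_restrict_mem measurableSet_Ioi] with u hu using hKin u hu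
    · refine (hf.norm.const_mul s.re⁻¹).congr ?_
      filter_upwards [ae_restrict_mem measurableSet_Ioi] with u hu
      exact (hK2 u hu).symm
  have hK3 : ∀ x : ℝ, 1 < x → ∫ u, K x u ∂μ = (∫ u in (1:ℝ)..x, f u) * (x:ℂ)^(-s-1) := by
    intro x hx
    have : ∀ u, K x u = (Iic x).indicator (fun u : ℝ => f u * (x:ℂ)^(-s-1)) u := by
      intro u
      by_cases hx : u ≤ x
      · simp [hK, hx]
      · simp [hK, hx]
    simp_rw [this]
    rw [integral_indicator measurableSet_Iic, hμ,
      Measure.restrict_restrict measurableSet_Iic, integral_mul_const,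
      intervalIntegral.integral_of_le hx.le, inter_comm, Ioi_inter_Iic]
  constructor
  · refine hIntg.integral_prod_left.congr ?_
    filter_upwards [ae_restrict_mem measurableSet_Ioi] with x hx
    exact hK3 x hx
  · have e := integral_integral_swap hIntg
    have e1 : ∫ x, ∫ u, K x u ∂μ ∂μ = ∫ x in Ioi (1:ℝ), (∫ u in (1:ℝ)..x, f u) * (x:ℂ)^(-s-1) :=
      setIntegral_congr_fun measurableSet_Ioi fun x hx => hK3 x hx
    have e2 : ∫ u, ∫ x, K x u ∂μ ∂μ = ∫ u in Ioi (1:ℝ), s⁻¹ * (f u * (u:ℂ)^(-s)) :=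
      setIntegral_congr_fun measurableSet_Ioi fun x hx => hK1 x hx
    rw [e1, e2, integral_const_mul] at e
    rw [e, ← mul_assoc, mul_inv_cancel₀ hs0, one_mul]
end

section
open Complex Set Filter Topology MeasureTheory

lemma mellin_bound (E : ℝ → ℂ) (R : ℂ → ℂ) (C : ℝ) (hC : 0 < C)
    (hEl : ∀ x : ℝ, 1 ≤ x → IntervalIntegrable E volume 1 x)
    (hEi : ∀ s : ℂ, 1 < s.re → IntegrableOn (fun x : ℝ => E x * (x:ℂ)^(-(s+1))) (Ioi 1))
    (hER : ∀ s : ℂ, 1 < s.re → s * ∫ x in Ioi (1:ℝ), E x * (x:ℂ)^(-(s+1)) = R s)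
    (hRc : ContinuousOn R HP)
    (hRb : ∀ s : ℂ, 1 < s.re → s.re ≤ 2 →
      ‖R s‖ ≤ C * ((s.re-1)⁻¹)^2 * (1+|s.im|)^(1/2:ℝ)) :
    ∃ C' > 0, ∀ x : ℝ, Real.exp 1 ≤ x → ‖∫ u in (1:ℝ)..x, E u‖ ≤ C' * x^2 * (Real.log x)^2 := by
  set E1 : ℝ → ℂ := fun x => if x ≤ 1 then 0 else ∫ u in (1:ℝ)..x, E u with hE1
  have hfub := fun (s : ℂ) (hs : 1 < s.re) => fub E (s+1) (by simp; linarith) (hEi s hs)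
  have hind : ∀ s : ℂ, ∀ x ∈ Ioi (0:ℝ), (x:ℂ)^(-(s+1)-1) • E1 x =
      (Ioi (1:ℝ)).indicator (fun x : ℝ => (∫ u in (1:ℝ)..x, E u) * (x:ℂ)^(-(s+1)-1)) x := by
    intro s x hx
    by_cases h : x ≤ 1
    · simp [hE1, h]
    · have h' : x ∈ Ioi (1:ℝ) := not_le.1 h
      rw [indicator_of_mem h']
      simp only [hE1, h, if_false, smul_eq_mul]
      ring
  have hinter : Ioi (1:ℝ) ∩ Ioi 0 = Ioi 1 := inter_eq_left.2 (Ioi_subset_Ioi zero_le_one)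
  have hMC : ∀ s : ℂ, 1 < s.re → MellinConvergent E1 (-(s+1)) := by
    intro s hs
    refine IntegrableOn.congr_fun ?_ (fun x hx => (hind s x hx).symm) measurableSet_Ioi
    rw [IntegrableOn, integrable_indicator_iff measurableSet_Ioi, IntegrableOn,
      Measure.restrict_restrict measurableSet_Ioi, hinter]
    exact (hfub s hs).1
  have hM : ∀ s : ℂ, 1 < s.re → mellin E1 (-(s+1)) = R s / (s * (s+1)) := by
    intro s hs
    have hs0 : s ≠ 0 := by rintro rfl; simp at hs; linarith
    have hs1 : s + 1 ≠ 0 := by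
      intro h; have := congrArg Complex.re h; simp at this; linarith
    rw [mellin, setIntegral_congr_fun measurableSet_Ioi (hind s), integral_indicator measurableSet_Ioi,
      Measure.restrict_restrict measurableSet_Ioi, hinter]
    rw [eq_div_iff (mul_ne_zero hs0 hs1), ← hER s hs, ← (hfub s hs).2]
    ring
  have hI := integrable_one_add_norm (E := ℝ) (μ := volume) (r := 3/2) (by simp; norm_num)
  set I0 := ∫ y : ℝ, (1 + ‖y‖)^(-(3/2):ℝ) with hI0
  have hI0n : 0 ≤ I0 := integral_nonneg fun y => by positivity
  refine ⟨4 * C * (I0 + 1) * Real.exp 1, by positivity, fun x hx => ?_⟩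
  have hx1 : 1 < x := by
    have : (1:ℝ) < Real.exp 1 := by simp
    linarith
  have hx0 : 0 < x := by linarith
  have hlog : 1 ≤ Real.log x := by
    rw [Real.le_log_iff_exp_le hx0]; exact hx
  have hlog0 : 0 < Real.log x := by linarith
  set ε := (Real.log x)⁻¹ with hε
  have hε0 : 0 < ε := by positivity
  have hε1 : ε ≤ 1 := inv_le_one_of_one_le₀ hlog
  set S : ℝ → ℂ := fun y => (1 + ε : ℝ) - y * I with hS
  have hSre : ∀ y, (S y).re = 1 + ε := by intro y; simp [hS]
  have hSim : ∀ y, (S y).im = -y := by intro y; simp [hS]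
  have hSH : ∀ y, 1 < (S y).re := by intro y; rw [hSre]; linarith
  have hSS : ∀ y : ℝ, (((-(2+ε) : ℝ)) : ℂ) + y * I = -(S y + 1) := by
    intro y; simp only [hS]; push_cast; ring
  have hb : ∀ y : ℝ, ‖mellin E1 (((-(2+ε) : ℝ) : ℂ) + y * I)‖ ≤
      (4 * C * (ε⁻¹)^2) * (1 + ‖y‖)^(-(3/2):ℝ) := by
    intro y
    rw [hSS, hM _ (hSH y), norm_div, norm_mul]
    have h1 := hRb (S y) (hSH y) (by rw [hSre]; linarith)
    rw [hSre, hSim, abs_neg, add_sub_cancel_left] at h1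
    have hp : 0 < 1 + |y| := by positivity
    have n1 : (1+|y|)/2 ≤ ‖S y‖ := by
      have a1 := Complex.abs_re_le_norm (S y)
      have a2 := Complex.abs_im_le_norm (S y)
      rw [hSre, abs_of_pos (by linarith)] at a1
      rw [hSim, abs_neg] at a2
      linarith
    have n2 : (1+|y|)/2 ≤ ‖S y + 1‖ := by
      have a1 := Complex.abs_re_le_norm (S y + 1)
      have a2 := Complex.abs_im_le_norm (S y + 1)
      rw [Complex.add_re, hSre, Complex.one_re, abs_of_pos (by linarith)] at a1
      rw [Complex.add_im, hSim, Complex.one_im, add_zero, abs_neg] at a2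
      linarith
    have n3 : ((1+|y|)/2) * ((1+|y|)/2) ≤ ‖S y‖ * ‖S y + 1‖ :=
      mul_le_mul n1 n2 (by positivity) (norm_nonneg _)
    calc ‖R (S y)‖ / (‖S y‖ * ‖S y + 1‖)
        ≤ (C * (ε⁻¹)^2 * (1+|y|)^(1/2:ℝ)) / (((1+|y|)/2) * ((1+|y|)/2)) :=
          div_le_div₀ (by positivity) h1 (by positivity) n3
      _ = (4 * C * (ε⁻¹)^2) * ((1+|y|)^(1/2:ℝ) * ((1+|y|)^2)⁻¹) := by field_simp; ring
      _ = _ := by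
          congr 1
          rw [Real.norm_eq_abs, ← Real.rpow_natCast, ← Real.rpow_neg hp.le, ← Real.rpow_add hp]
          norm_num
  have hSc : Continuous S := by simp only [hS]; fun_prop
  have hcont : Continuous (fun y : ℝ => mellin E1 (((-(2+ε) : ℝ) : ℂ) + y * I)) := by
    have : (fun y : ℝ => mellin E1 (((-(2+ε) : ℝ) : ℂ) + y * I)) =
        fun y => R (S y) / (S y * (S y + 1)) := by
      funext y; rw [hSS, hM _ (hSH y)]
    rw [this]
    refine Continuous.div (hRc.comp_continuous hSc hSH) (by fun_prop) ?_
    intro y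
    refine mul_ne_zero ?_ ?_
    · intro h; have := congrArg Complex.re h; rw [hSre] at this; simp at this; linarith
    · intro h; have := congrArg Complex.re h; rw [Complex.add_re, hSre] at this; simp at this; linarith
  have hvi : VerticalIntegrable (mellin E1) (-(2+ε)) := by
    refine Integrable.mono' (hI.const_mul (4 * C * (ε⁻¹)^2)) hcont.aestronglyMeasurable ?_
    exact Eventually.of_forall hb
  have hE1x : ∀ y : ℝ, 1 < y → E1 y = ∫ u in (1:ℝ)..y, E u := by
    intro y hy; simp [hE1, not_le.2 hy]
  have hca : ContinuousAt E1 x := by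
    have h1 : ContinuousOn (fun b => ∫ u in (1:ℝ)..b, E u) (uIcc 1 (x+1)) :=
      intervalIntegral.continuousOn_primitive_interval' (hEl (x+1) (by linarith)) left_mem_uIcc
    rw [uIcc_of_le (by linarith)] at h1
    have h2 := h1.continuousAt (Icc_mem_nhds hx1 (by linarith))
    refine h2.congr ?_
    filter_upwards [lt_mem_nhds hx1] with y hy
    exact (hE1x y hy).symm
  have hconv : MellinConvergent E1 ((-(2+ε) : ℝ) : ℂ) := by
    have := hMC ((1+ε : ℝ) : ℂ) (by simp; linarith)
    convert this using 1
    push_cast; ring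
  have hinv := mellinInv_mellin_eq (-(2+ε)) E1 hx0 hconv hvi hca
  rw [← hE1x x hx1, ← hinv, mellinInv, norm_smul]
  have hxε : x ^ (2+ε) = x^2 * Real.exp 1 := by
    rw [Real.rpow_add hx0, Real.rpow_two]
    congr 1
    rw [Real.rpow_def_of_pos hx0, hε, mul_inv_cancel₀ hlog0.ne']
  have hbint : ‖∫ y : ℝ, (x:ℂ)^(-(((-(2+ε) : ℝ) : ℂ) + y * I)) • mellin E1 (((-(2+ε) : ℝ) : ℂ) + y * I)‖ ≤
      ∫ y : ℝ, (x^(2+ε) * (4 * C * (ε⁻¹)^2)) * (1 + ‖y‖)^(-(3/2):ℝ) := by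
    refine norm_integral_le_of_norm_le (hI.const_mul _) (Eventually.of_forall fun y => ?_)
    rw [norm_smul, Complex.norm_cpow_eq_rpow_re_of_pos hx0, mul_assoc]
    have : (-(((-(2+ε) : ℝ) : ℂ) + y * I)).re = 2 + ε := by simp
    rw [this]
    exact mul_le_mul_of_nonneg_left (hb y) (by positivity)
  rw [integral_const_mul] at hbint
  have hpi : ‖1 / (2 * Real.pi)‖ ≤ 1 := by
    rw [Real.norm_of_nonneg (by positivity), div_le_one (by positivity)]
    linarith [Real.pi_gt_three]
  refine (mul_le_mul hpi hbint (norm_nonneg _) zero_le_one).trans ?_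
  rw [hxε, ← hI0, hε, inv_inv, one_mul]
  have : 0 ≤ x^2 * Real.exp 1 * (4 * C * Real.log x^2) := by positivity
  nlinarith
end

section
open Complex Set Filter Topology MeasureTheory

noncomputable def bb (a : ℕ → ℂ) (k : ℕ) (n : ℕ) : ℂ := ((Real.log n : ℝ) : ℂ)^k * a n

noncomputable def TT (a : ℕ → ℂ) (k : ℕ) (x : ℝ) : ℂ := ∑ n ∈ Finset.Icc 1 ⌊x⌋₊, bb a k n

noncomputable def MM (z : ℂ) (k : ℕ) (c : ℕ → ℂ) (u : ℝ) : ℂ :=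
  ∑ j ∈ Finset.range (k-1), (c j / Gamma (z+k-j)) * ((Real.log u : ℝ) : ℂ)^(z+k-j-1)

noncomputable def EE (a : ℕ → ℂ) (z : ℂ) (k : ℕ) (c : ℕ → ℂ) (x : ℝ) : ℂ :=
  TT a k x - ∫ u in (1:ℝ)..x, MM z k c u

lemma logMul_iter (a : ℕ → ℂ) (k : ℕ) : LSeries.logMul^[k] a = bb a k := by
  induction k with
  | zero => funext n; simp [bb]
  | succ k ih =>
    rw [Function.iterate_succ_apply', ih]
    funext n
    simp only [LSeries.logMul, bb, ← Complex.natCast_log]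
    ring

lemma bb_LSeries {a : ℕ → ℂ} (hb : ∀ n, ‖a n‖ ≤ 1) (k : ℕ) {s : ℂ} (hs : 1 < s.re) :
    (-1)^k * iteratedDeriv k (LSeries a) s = LSeries (bb a k) s := by
  have hab : LSeries.abscissaOfAbsConv a < s.re := by
    refine lt_of_le_of_lt (LSeries.abscissaOfAbsConv_le_one_of_isBigO_one ?_) (by exact_mod_cast hs)
    exact Asymptotics.IsBigO.of_bound 1 (Eventually.of_forall fun n => by simpa using hb n)
  rw [LSeries_iteratedDeriv k hab, logMul_iter, ← mul_assoc, ← mul_pow]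
  simp

lemma sum_bb {a : ℕ → ℂ} (hb : ∀ n, ‖a n‖ ≤ 1) (k : ℕ) {x : ℝ} (hx : 1 ≤ x) :
    ∑ n ∈ Finset.Icc 1 ⌊x⌋₊, ‖bb a k n‖ ≤ x * (Real.log x)^k := by
  calc ∑ n ∈ Finset.Icc 1 ⌊x⌋₊, ‖bb a k n‖ ≤ ∑ n ∈ Finset.Icc 1 ⌊x⌋₊, (Real.log x)^k := by
        refine Finset.sum_le_sum fun n hn => ?_
        rw [Finset.mem_Icc] at hn
        have hn1 : (1:ℝ) ≤ n := by exact_mod_cast hn.1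
        have hn2 : (n:ℝ) ≤ x := (Nat.le_floor_iff (by linarith)).1 hn.2
        have hl := Real.log_nonneg hn1
        have : Real.log n ≤ Real.log x := Real.log_le_log (by linarith) hn2
        rw [bb, norm_mul, norm_pow, Complex.norm_real, Real.norm_of_nonneg hl]
        calc Real.log n ^ k * ‖a n‖ ≤ Real.log x ^ k * 1 :=
              mul_le_mul (pow_le_pow_left₀ hl this k) (hb n) (norm_nonneg _) (pow_nonneg (hl.trans this) k)
          _ = _ := mul_one _
    _ = ⌊x⌋₊ * (Real.log x)^k := by simp
    _ ≤ x * (Real.log x)^k := by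
        have := Real.log_nonneg hx
        exact mul_le_mul_of_nonneg_right (Nat.floor_le (by linarith)) (by positivity)

lemma TT_norm {a : ℕ → ℂ} (hb : ∀ n, ‖a n‖ ≤ 1) (k : ℕ) {x : ℝ} (hx : 1 ≤ x) :
    ‖TT a k x‖ ≤ x * (Real.log x)^k := (norm_sum_le _ _).trans (sum_bb hb k hx)

lemma log_pow_le (k : ℕ) {δ : ℝ} (hδ : 0 < δ) : ∃ C > 0, ∀ x : ℝ, 1 ≤ x → (Real.log x)^k ≤ C * x^δ := by
  rcases Nat.eq_zero_or_pos k with rfl | hk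
  · refine ⟨1, one_pos, fun x hx => ?_⟩
    simpa using Real.one_le_rpow hx hδ.le
  have hk' : (0:ℝ) < k := by exact_mod_cast hk
  refine ⟨((δ/k)⁻¹)^k, by positivity, fun x hx => ?_⟩
  have h0 : 0 ≤ x := by linarith
  have h1 := Real.log_le_rpow_div h0 (ε := δ/k) (by positivity)
  calc (Real.log x)^k ≤ (x^(δ/k) / (δ/k))^k := pow_le_pow_left₀ (Real.log_nonneg hx) h1 k
    _ = ((δ/k)⁻¹)^k * (x^(δ/k))^k := by rw [div_eq_inv_mul, mul_pow]
    _ = _ := by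
      rw [← Real.rpow_natCast (x^(δ/k)), ← Real.rpow_mul h0, div_mul_cancel₀ _ hk'.ne']

lemma TT_meas (a : ℕ → ℂ) (k : ℕ) : Measurable (TT a k) :=
  (measurable_from_nat (f := fun m : ℕ => ∑ n ∈ Finset.Icc 1 m, bb a k n)).comp Nat.measurable_floor

lemma TT_int {a : ℕ → ℂ} (hb : ∀ n, ‖a n‖ ≤ 1) (k : ℕ) {s : ℂ} (hs : 1 < s.re) :
    IntegrableOn (fun x : ℝ => TT a k x * (x:ℂ)^(-(s+1))) (Ioi 1) ∧
    s * ∫ x in Ioi (1:ℝ), TT a k x * (x:ℂ)^(-(s+1)) = LSeries (bb a k) s := by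
  set δ := (s.re - 1)/2 with hδ
  have hδ0 : 0 < δ := by rw [hδ]; linarith
  obtain ⟨C, hC, hCb⟩ := log_pow_le k hδ0
  constructor
  · have h1 : IntegrableOn (fun x : ℝ => C * x^(δ - s.re)) (Ioi 1) :=
      (integrableOn_Ioi_rpow_of_lt (by linarith) one_pos).const_mul C
    refine Integrable.mono' h1 ?_ ?_
    · exact ((TT_meas a k).mul (by fun_prop)).aestronglyMeasurable
    · filter_upwards [ae_restrict_mem measurableSet_Ioi] with x hx
      have hx1 : 1 < x := hx
      have hx0 : 0 < x := by linarith
      rw [norm_mul, Complex.norm_cpow_eq_rpow_re_of_pos hx0]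
      have h2 := TT_norm hb k hx1.le
      have h3 : ‖TT a k x‖ ≤ x * (C * x^δ) :=
        h2.trans (mul_le_mul_of_nonneg_left (hCb x hx1.le) hx0.le)
      calc _ ≤ x * (C * x^δ) * x^(-(s+1)).re := mul_le_mul_of_nonneg_right h3 (by positivity)
        _ = C * (x^(1:ℝ) * x^δ * x^(-(s+1)).re) := by rw [Real.rpow_one]; ring
        _ = _ := by
          rw [← Real.rpow_add hx0, ← Real.rpow_add hx0]
          congr 2; simp; ring
  · refine (LSeries_eq_mul_integral' (bb a k) (r := 1 + δ) (by linarith) (by linarith) ?_).symm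
    refine Asymptotics.IsBigO.of_bound C ?_
    filter_upwards [eventually_ge_atTop 1] with n hn
    have hn1 : (1:ℝ) ≤ n := by exact_mod_cast hn
    have hn0 : (0:ℝ) < n := by linarith
    have := sum_bb hb k hn1
    rw [Nat.floor_natCast] at this
    rw [Real.norm_of_nonneg (Finset.sum_nonneg fun _ _ => norm_nonneg _),
      Real.norm_of_nonneg (by positivity), Real.rpow_add hn0, Real.rpow_one]
    have h4 := mul_le_mul_of_nonneg_left (hCb n hn1) hn0.le
    linarith

lemma MM_int {z : ℂ} (hz : -1 ≤ z.re) {k : ℕ} (c : ℕ → ℂ) {s : ℂ} (hs : 1 < s.re) :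
    IntegrableOn (fun u : ℝ => MM z k c u * (u:ℂ)^(-s)) (Ioi 1) ∧
    ∫ u in Ioi (1:ℝ), MM z k c u * (u:ℂ)^(-s) =
      ∑ j ∈ Finset.range (k - 1), c j * (s - 1) ^ ((j : ℂ) - z - k) := by
  have hre : ∀ j ∈ Finset.range (k-1), 0 < (z+k-j).re := by
    intro j hj
    rw [Finset.mem_range] at hj
    have : (j:ℝ) + 2 ≤ k := by exact_mod_cast (by omega : j + 2 ≤ k)
    simp; linarith
  have e : (fun u : ℝ => MM z k c u * (u:ℂ)^(-s)) = fun u : ℝ => ∑ j ∈ Finset.range (k-1),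
      (c j / Gamma (z+k-j)) * (((Real.log u : ℝ) : ℂ)^(z+k-j-1) * (u:ℂ)^(-s)) := by
    funext u; simp only [MM, Finset.sum_mul, mul_assoc]
  have hi : ∀ j ∈ Finset.range (k-1), IntegrableOn (fun u : ℝ => (c j / Gamma (z+k-j)) *
      (((Real.log u : ℝ) : ℂ)^(z+k-j-1) * (u:ℂ)^(-s))) (Ioi 1) := fun j hj =>
    ((logpow_int (z+k-j) s (hre j hj) hs).1).const_mul _
  rw [e]
  constructor
  · exact integrable_finsetSum _ hi
  · rw [integral_finsetSum _ hi]
    refine Finset.sum_congr rfl fun j hj => ?_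
    rw [integral_const_mul, (logpow_int (z+k-j) s (hre j hj) hs).2]
    have := Complex.Gamma_ne_zero_of_re_pos (hre j hj)
    rw [show -(z+k-j) = (j:ℂ) - z - k by ring]
    field_simp

lemma ii_of_int {f : ℝ → ℂ} {s : ℂ} (hf : IntegrableOn (fun u : ℝ => f u * (u:ℂ)^(-s)) (Ioi 1)) {x : ℝ}
    (hx : 1 ≤ x) : IntervalIntegrable f volume 1 x := by
  rw [intervalIntegrable_iff_integrableOn_Ioc_of_le hx]
  have h1 := hf.mono_set (fun u (hu : u ∈ Ioc 1 x) => (hu.1 : u ∈ Ioi 1))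
  have hc : ContinuousOn (fun u : ℝ => (u:ℂ)^s) (Icc 1 x) := fun t ht =>
    (Complex.continuousAt_ofReal_cpow_const _ _
      (Or.inr (ne_of_gt (zero_lt_one.trans_le ht.1)))).continuousWithinAt
  refine (h1.mul_continuousOn_of_subset hc measurableSet_Ioc isCompact_Icc Ioc_subset_Icc_self).congr_fun
    (fun u hu => ?_) measurableSet_Ioc
  have hu0 : (u:ℂ) ≠ 0 := by exact_mod_cast (zero_lt_one.trans hu.1).ne'
  simp only
  rw [mul_assoc, ← Complex.cpow_add _ _ hu0]; simp

lemma EE_int {a : ℕ → ℂ} (hb : ∀ n, ‖a n‖ ≤ 1) {z : ℂ} (hz : -1 ≤ z.re) {k : ℕ} (c : ℕ → ℂ) {s : ℂ}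
    (hs : 1 < s.re) :
    IntegrableOn (fun x : ℝ => EE a z k c x * (x:ℂ)^(-(s+1))) (Ioi 1) ∧
    s * ∫ x in Ioi (1:ℝ), EE a z k c x * (x:ℂ)^(-(s+1)) = RR a z k c s := by
  have h1 := TT_int hb k hs
  have h2 := MM_int hz (k := k) c hs
  have h3 := fub (MM z k c) s (by linarith) h2.1
  rw [show -s - 1 = -(s+1) by ring] at h3
  have e : (fun x : ℝ => EE a z k c x * (x:ℂ)^(-(s+1))) = fun x : ℝ =>
      TT a k x * (x:ℂ)^(-(s+1)) - (∫ u in (1:ℝ)..x, MM z k c u) * (x:ℂ)^(-(s+1)) := by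
    funext x; rw [EE, sub_mul]
  rw [e]
  refine ⟨h1.1.sub h3.1, ?_⟩
  rw [integral_sub h1.1 h3.1, mul_sub, h1.2, h3.2, h2.2, RR, bb_LSeries hb k hs]

lemma EE_ii {a : ℕ → ℂ} (hb : ∀ n, ‖a n‖ ≤ 1) {z : ℂ} (hz : -1 ≤ z.re) {k : ℕ} (c : ℕ → ℂ) {x : ℝ}
    (hx : 1 ≤ x) : IntervalIntegrable (EE a z k c) volume 1 x :=
  ii_of_int (EE_int hb hz c (s := 2) (by simp)).1 hx

lemma MM_ii {z : ℂ} (hz : -1 ≤ z.re) {k : ℕ} (c : ℕ → ℂ) {x : ℝ}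
    (hx : 1 ≤ x) : IntervalIntegrable (MM z k c) volume 1 x :=
  ii_of_int (MM_int hz (k := k) c (s := 2) (by simp)).1 hx

theorem EE1_bound {a : ℕ → ℂ} {z : ℂ} (h : Dat a z) {k : ℕ} (hk : 2 ≤ k) :
    ∃ c : ℕ → ℂ, c 0 = (∏ i ∈ Finset.range k, (z + i)) * FT a z 1 ∧ ∃ C > 0,
      ∀ x : ℝ, Real.exp 1 ≤ x → ‖∫ u in (1:ℝ)..x, EE a z k c u‖ ≤ C * x^2 * (Real.log x)^2 := by
  obtain ⟨c, hc0, C, hC, hCb⟩ := RR_bound h hk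
  have hz : -1 ≤ z.re := by
    have := (abs_le.1 ((Complex.abs_re_le_norm z).trans h.norm_z)).1
    linarith
  refine ⟨c, hc0, mellin_bound (EE a z k c) (RR a z k c) C hC (fun x hx => EE_ii h.bd hz c hx)
    (fun s hs => (EE_int h.bd hz c hs).1) (fun s hs => (EE_int h.bd hz c hs).2)
    (RR_diff h k c).continuousOn hCb⟩
end

section
open Complex Set Filter Topology MeasureTheory

lemma norm_logpow {u : ℝ} (hu : 1 < u) (w : ℂ) :
    ‖((Real.log u : ℝ) : ℂ)^w‖ = (Real.log u)^w.re :=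
  Complex.norm_cpow_eq_rpow_re_of_pos (Real.log_pos hu) w

lemma exp_one_facts {x : ℝ} (hx : Real.exp 1 ≤ x) : 1 < x ∧ 1 ≤ Real.log x := by
  have : (1:ℝ) < Real.exp 1 := by simp
  refine ⟨by linarith, ?_⟩
  rw [Real.le_log_iff_exp_le (by linarith)]; exact hx

lemma MM_bound {z : ℂ} (hz : z.re ≤ 1) (k : ℕ) (c : ℕ → ℂ) : ∃ C > 0, ∀ u : ℝ, Real.exp 1 ≤ u →
    ‖MM z k c u‖ ≤ C * (Real.log u)^k := by
  refine ⟨(∑ j ∈ Finset.range (k-1), ‖c j / Gamma (z+k-j)‖) + 1, ?_, fun u hu => ?_⟩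
  · have : 0 ≤ ∑ j ∈ Finset.range (k-1), ‖c j / Gamma (z+k-j)‖ :=
      Finset.sum_nonneg fun _ _ => norm_nonneg _
    linarith
  obtain ⟨hu1, hl⟩ := exp_one_facts hu
  have hl0 : 0 ≤ (Real.log u)^k := by positivity
  calc ‖MM z k c u‖ ≤ ∑ j ∈ Finset.range (k-1), ‖c j / Gamma (z+k-j)‖ * (Real.log u)^k := by
        refine norm_sum_le_of_le _ fun j hj => ?_
        rw [norm_mul, norm_logpow hu1]
        refine mul_le_mul_of_nonneg_left ?_ (norm_nonneg _)
        rw [← Real.rpow_natCast]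
        refine Real.rpow_le_rpow_of_exponent_le hl ?_
        have : (0:ℝ) ≤ j := by positivity
        simp; linarith
    _ = (∑ j ∈ Finset.range (k-1), ‖c j / Gamma (z+k-j)‖) * (Real.log u)^k := by rw [Finset.sum_mul]
    _ ≤ _ := mul_le_mul_of_nonneg_right (by linarith) hl0

lemma TT_diff {a : ℕ → ℂ} (hb : ∀ n, ‖a n‖ ≤ 1) (k : ℕ) {x u : ℝ} (hx : 1 ≤ x) (hu : x ≤ u) :
    ‖TT a k u - TT a k x‖ ≤ (u - x + 1) * (Real.log u)^k := by
  have hf : ⌊x⌋₊ ≤ ⌊u⌋₊ := Nat.floor_le_floor hu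
  have e : TT a k u - TT a k x = ∑ n ∈ Finset.Ioc ⌊x⌋₊ ⌊u⌋₊, bb a k n := by
    rw [TT, TT, sub_eq_iff_eq_add']
    have h1 : ∀ m : ℕ, Finset.Icc 1 m = Finset.Ioc 0 m := fun m => rfl
    rw [h1, h1, Finset.sum_Ioc_consecutive _ (Nat.zero_le _) hf]
  rw [e]
  have hlu : 0 ≤ Real.log u := Real.log_nonneg (by linarith)
  calc ‖∑ n ∈ Finset.Ioc ⌊x⌋₊ ⌊u⌋₊, bb a k n‖ ≤ ∑ n ∈ Finset.Ioc ⌊x⌋₊ ⌊u⌋₊, (Real.log u)^k := by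
        refine norm_sum_le_of_le _ fun n hn => ?_
        rw [Finset.mem_Ioc] at hn
        have hn1 : (1:ℝ) ≤ n := by exact_mod_cast (by omega : 1 ≤ n)
        have hn2 : (n:ℝ) ≤ u := (Nat.le_floor_iff (by linarith)).1 hn.2
        have hl := Real.log_nonneg hn1
        have : Real.log n ≤ Real.log u := Real.log_le_log (by linarith) hn2
        rw [bb, norm_mul, norm_pow, Complex.norm_real, Real.norm_of_nonneg hl]
        calc Real.log n ^ k * ‖a n‖ ≤ Real.log u ^ k * 1 :=
              mul_le_mul (pow_le_pow_left₀ hl this k) (hb n) (norm_nonneg _) (pow_nonneg (hl.trans this) k)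
          _ = _ := mul_one _
    _ = ((⌊u⌋₊ : ℝ) - ⌊x⌋₊) * (Real.log u)^k := by simp [Nat.cast_sub hf]
    _ ≤ (u - x + 1) * (Real.log u)^k := by
        refine mul_le_mul_of_nonneg_right ?_ (by positivity)
        have h1 := Nat.floor_le (show 0 ≤ u by linarith)
        have h2 := Nat.lt_floor_add_one x
        linarith

theorem EE_bound {a : ℕ → ℂ} {z : ℂ} (h : Dat a z) :
    ∃ c : ℕ → ℂ, c 0 = (∏ i ∈ Finset.range 8, (z + i)) * FT a z 1 ∧ ∃ C > 0,
      ∀ x : ℝ, Real.exp 1 ≤ x → ‖EE a z 8 c x‖ ≤ C * x * (Real.log x)^5 := by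
  obtain ⟨c, hc0, C, hC, hCb⟩ := EE1_bound h (k := 8) (by norm_num)
  have hz' := abs_le.1 ((Complex.abs_re_le_norm z).trans h.norm_z)
  have hz : -1 ≤ z.re := hz'.1
  obtain ⟨Cm, hCm, hM⟩ := MM_bound hz'.2 8 c
  obtain ⟨C3, hC3, h3⟩ := log_pow_le 3 (one_pos)
  refine ⟨c, hc0, 17 * C + (1 + C3 + Cm) * 2^8, by positivity, fun x hx => ?_⟩
  obtain ⟨hx1, hl⟩ := exp_one_facts hx
  have hx0 : 0 < x := by linarith
  set L := Real.log x with hL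
  have hL0 : 0 < L := by linarith
  set δ := x / L^3 with hδ
  have hδ0 : 0 < δ := by positivity
  have hδx : δ ≤ x := div_le_self hx0.le (one_le_pow₀ hl)
  have hlog2 : ∀ u, x ≤ u → u ≤ x + δ → Real.log u ≤ 2 * L := by
    intro u h1 h2
    have : Real.log u ≤ Real.log (Real.exp 1 * x) := by
      refine Real.log_le_log (by linarith) ?_
      have : (2:ℝ) ≤ Real.exp 1 := by have := Real.add_one_le_exp 1; linarith
      nlinarith
    rw [Real.log_mul (Real.exp_pos 1).ne' hx0.ne', Real.log_exp] at this
    linarith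
  set Q := (δ + 1) * (2*L)^8 + δ * (Cm * (2*L)^8) with hQ
  have hdiff : ∀ u ∈ Icc x (x+δ), ‖EE a z 8 c x - EE a z 8 c u‖ ≤ Q := by
    intro u hu
    have hlu := hlog2 u hu.1 hu.2
    have hlu0 : 0 ≤ Real.log u := Real.log_nonneg (by linarith [hu.1])
    have hp : (Real.log u)^8 ≤ (2*L)^8 := pow_le_pow_left₀ hlu0 hlu 8
    have i1 := MM_ii hz (k := 8) c hx1.le
    have i2 := MM_ii hz (k := 8) c (x := u) (by linarith [hu.1])
    have e : EE a z 8 c x - EE a z 8 c u = -(TT a 8 u - TT a 8 x) + ∫ v in x..u, MM z 8 c v := by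
      rw [EE, EE, ← intervalIntegral.integral_interval_sub_left i2 i1]; ring
    rw [e]
    refine (norm_add_le _ _).trans (add_le_add ?_ ?_)
    · rw [norm_neg]
      refine (TT_diff h.bd 8 hx1.le hu.1).trans ?_
      exact mul_le_mul (by linarith [hu.2]) hp (by positivity) (by positivity)
    · have := intervalIntegral.norm_integral_le_of_norm_le_const (a := x) (b := u)
        (f := MM z 8 c) (C := Cm * (2*L)^8) (fun v hv => by
          rw [uIoc_of_le hu.1] at hv
          refine (hM v (by linarith [hv.1])).trans ?_
          refine mul_le_mul_of_nonneg_left ?_ hCm.le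
          exact pow_le_pow_left₀ (Real.log_nonneg (by linarith [hv.1]))
            (hlog2 v hv.1.le (hv.2.trans hu.2)) 8)
      refine this.trans ?_
      rw [abs_of_nonneg (by linarith [hu.1]), mul_comm]
      exact mul_le_mul_of_nonneg_right (by linarith [hu.2]) (by positivity)
  have j1 := EE_ii h.bd hz (k := 8) c hx1.le
  have j2 := EE_ii h.bd hz (k := 8) c (x := x+δ) (by linarith)
  have j3 : IntervalIntegrable (EE a z 8 c) volume x (x+δ) := j1.symm.trans j2
  have e2 : (δ:ℂ) * EE a z 8 c x = (∫ u in x..(x+δ), (EE a z 8 c x - EE a z 8 c u)) +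
      ((∫ u in (1:ℝ)..(x+δ), EE a z 8 c u) - ∫ u in (1:ℝ)..x, EE a z 8 c u) := by
    rw [intervalIntegral.integral_sub intervalIntegrable_const j3,
      intervalIntegral.integral_interval_sub_left j2 j1, intervalIntegral.integral_const]
    simp
  have b1 : ‖∫ u in x..(x+δ), (EE a z 8 c x - EE a z 8 c u)‖ ≤ Q * δ := by
    have := intervalIntegral.norm_integral_le_of_norm_le_const (a := x) (b := x+δ)
        (f := fun u => EE a z 8 c x - EE a z 8 c u) (C := Q) (fun v hv => by
          rw [uIoc_of_le (by linarith)] at hv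
          exact hdiff v ⟨hv.1.le, hv.2⟩)
    rwa [add_sub_cancel_left, abs_of_pos hδ0] at this
  have b2 := hCb x hx
  have b3 := hCb (x+δ) (by linarith)
  have b3' : ‖∫ u in (1:ℝ)..(x+δ), EE a z 8 c u‖ ≤ C * (2*x)^2 * (2*L)^2 := by
    refine b3.trans ?_
    have h1 : (x+δ)^2 ≤ (2*x)^2 := pow_le_pow_left₀ (by positivity) (by linarith) 2
    have h2 : (Real.log (x+δ))^2 ≤ (2*L)^2 :=
      pow_le_pow_left₀ (Real.log_nonneg (by linarith)) (hlog2 _ (by linarith) le_rfl) 2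
    exact mul_le_mul (mul_le_mul_of_nonneg_left h1 hC.le) h2 (by positivity) (by positivity)
  have b4 : δ * ‖EE a z 8 c x‖ ≤ Q * δ + (C * (2*x)^2 * (2*L)^2 + C * x^2 * L^2) := by
    have : δ * ‖EE a z 8 c x‖ = ‖(δ:ℂ) * EE a z 8 c x‖ := by
      rw [norm_mul, Complex.norm_real, Real.norm_of_nonneg hδ0.le]
    rw [this, e2]
    exact (norm_add_le _ _).trans (add_le_add b1 ((norm_sub_le _ _).trans (add_le_add b3' b2)))
  have hδL : δ * L^3 = x := by rw [hδ]; field_simp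
  have b5 : ‖EE a z 8 c x‖ ≤ Q + 17 * C * x * L^5 := by
    have : δ * ‖EE a z 8 c x‖ ≤ δ * (Q + 17 * C * x * L^5) := by
      refine b4.trans (le_of_eq ?_)
      have : δ * (17 * C * x * L^5) = 17 * C * x * L^2 * (δ * L^3) := by ring
      rw [mul_add, this, hδL]; ring
    exact le_of_mul_le_mul_left this hδ0
  have hLx := h3 x hx1.le
  rw [Real.rpow_one] at hLx
  have b6 : Q ≤ (1 + C3 + Cm) * 2^8 * x * L^5 := by
    have e1 : Q = ((δ * L^3) * (1+Cm) + L^3) * (2^8 * L^5) := by rw [hQ]; ring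
    rw [e1, hδL]
    have : x * (1+Cm) + L^3 ≤ (1 + C3 + Cm) * x := by linarith
    calc _ ≤ ((1 + C3 + Cm) * x) * (2^8 * L^5) := mul_le_mul_of_nonneg_right this (by positivity)
      _ = _ := by ring
  linarith
end

section
open Complex Set Filter Topology MeasureTheory

lemma gamma_prod (z : ℂ) (k : ℕ) :
    (∏ i ∈ Finset.range k, (z + i)) * (Gamma (z + k))⁻¹ = (Gamma z)⁻¹ := by
  induction k with
  | zero => simp
  | succ k ih =>
    rw [← ih, Finset.prod_range_succ, Complex.one_div_Gamma_eq_self_mul_one_div_Gamma_add_one (z+k)]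
    push_cast; ring_nf

lemma logint (w : ℂ) (hw : 0 ≤ w.re) {x : ℝ} (hx : Real.exp 1 ≤ x) :
    ‖∫ u in (1:ℝ)..x, ((Real.log u : ℝ) : ℂ)^w‖ ≤ x * (Real.log x)^w.re := by
  obtain ⟨hx1, hl⟩ := exp_one_facts hx
  have := intervalIntegral.norm_integral_le_of_norm_le_const (a := 1) (b := x)
    (f := fun u : ℝ => ((Real.log u : ℝ) : ℂ)^w) (C := (Real.log x)^w.re) (fun u hu => by
      rw [uIoc_of_le hx1.le] at hu
      rw [norm_logpow hu.1]
      exact Real.rpow_le_rpow (Real.log_nonneg hu.1.le) (Real.log_le_log (by linarith [hu.1]) hu.2) hw)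
  refine this.trans ?_
  rw [mul_comm, abs_of_pos (by linarith)]
  exact mul_le_mul_of_nonneg_right (by linarith) (by positivity)

lemma logpow_cont (β : ℂ) (hβ : 0 < β.re) : ContinuousOn (fun u : ℝ => ((Real.log u : ℝ) : ℂ)^β) (Ici 1) := by
  intro u hu
  have hu0 : u ≠ 0 := (zero_lt_one.trans_le hu).ne'
  have h1 : ContinuousAt (fun t : ℝ => (t:ℂ)^β) (Real.log u) :=
    Complex.continuousAt_ofReal_cpow_const _ _ (Or.inl hβ)
  exact (ContinuousAt.comp (f := Real.log) h1 (Real.continuousAt_log hu0)).continuousWithinAt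

lemma logint2 (β : ℂ) (hβ : 1 < β.re) {x : ℝ} (hx : 1 ≤ x) :
    ∫ u in (1:ℝ)..x, ((Real.log u : ℝ) : ℂ)^β =
      x * ((Real.log x : ℝ) : ℂ)^β - β * ∫ u in (1:ℝ)..x, ((Real.log u : ℝ) : ℂ)^(β-1) := by
  have hsub : uIcc 1 x ⊆ Ici 1 := by rw [uIcc_of_le hx]; exact Icc_subset_Ici_self
  have c0 := logpow_cont β (by linarith)
  have c1 := logpow_cont (β-1) (by simp; linarith)
  have i0 : IntervalIntegrable (fun u : ℝ => ((Real.log u : ℝ) : ℂ)^β) volume 1 x :=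
    (c0.mono hsub).intervalIntegrable
  have i1 : IntervalIntegrable (fun u : ℝ => β * ((Real.log u : ℝ) : ℂ)^(β-1)) volume 1 x :=
    (c1.mono hsub).intervalIntegrable.const_mul β
  have := intervalIntegral.integral_eq_sub_of_hasDerivAt_of_le hx
    (f := fun u : ℝ => (u:ℂ) * ((Real.log u : ℝ) : ℂ)^β)
    (f' := fun u : ℝ => ((Real.log u : ℝ) : ℂ)^β + β * ((Real.log u : ℝ) : ℂ)^(β-1))
    ((Complex.continuous_ofReal.continuousOn).mul (c0.mono Icc_subset_Ici_self)) ?_ (i0.add i1)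
  · rw [intervalIntegral.integral_add i0 i1, intervalIntegral.integral_const_mul] at this
    have hβ0 : β ≠ 0 := by rintro rfl; simp at hβ; linarith
    simp [Complex.zero_cpow hβ0] at this
    rw [← this]; simp
  · intro u hu
    have hu0 : u ≠ 0 := by linarith [hu.1]
    have hu0' : (u:ℂ) ≠ 0 := by exact_mod_cast hu0
    have hl := Real.log_pos hu.1
    have d1 : HasDerivAt (fun u : ℝ => (u:ℂ)) 1 u := Complex.ofRealCLM.hasDerivAt
    have d2 : HasDerivAt (fun u : ℝ => ((Real.log u : ℝ) : ℂ)) ((u⁻¹ : ℝ) : ℂ) u :=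
      (Real.hasDerivAt_log hu0).ofReal_comp
    have d3 : HasDerivAt (fun u : ℝ => ((Real.log u : ℝ) : ℂ)^β)
        (β * ((Real.log u : ℝ) : ℂ)^(β-1) * ((u⁻¹ : ℝ) : ℂ)) u := by
      have hs : ((Real.log u : ℝ) : ℂ) ∈ slitPlane := by
        rw [Complex.ofReal_mem_slitPlane]; exact hl
      have := (hasDerivAt_id ((Real.log u : ℝ) : ℂ)).cpow_const (c := β) hs
      have h4 := HasDerivAt.comp_of_eq u (h₂ := fun y : ℂ => y^β) this d2 rfl
      simpa [Function.comp_def] using h4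
    refine (d1.fun_mul d3).congr_deriv ?_
    push_cast
    field_simp

theorem TT_asym {a : ℕ → ℂ} {z : ℂ} (h : Dat a z) : ∃ C > 0, ∀ x : ℝ, Real.exp 1 ≤ x →
    ‖TT a 8 x - (Gamma z)⁻¹ * FT a z 1 * x * ((Real.log x : ℝ) : ℂ)^(z+7)‖ ≤
      C * x * (Real.log x)^(z.re+6) := by
  obtain ⟨c, hc0, C, hC, hE⟩ := EE_bound h
  have hz' := abs_le.1 ((Complex.abs_re_le_norm z).trans h.norm_z)
  have hz : -1 ≤ z.re := hz'.1
  set m : ℕ → ℂ := fun j => c j / Gamma (z+(8:ℕ)-j) with hm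
  have hm0 : m 0 = (Gamma z)⁻¹ * FT a z 1 := by
    simp only [hm]
    rw [hc0, ← gamma_prod z 8]
    simp only [Nat.cast_zero, sub_zero]
    ring
  set B := ∑ j ∈ Finset.range 6, ‖m (j+1)‖ with hB
  have hB0 : 0 ≤ B := Finset.sum_nonneg fun _ _ => norm_nonneg _
  refine ⟨C + ‖m 0‖ * ‖z+7‖ + B, by positivity, fun x hx => ?_⟩
  obtain ⟨hx1, hl⟩ := exp_one_facts hx
  have hx0 : 0 < x := by linarith
  set Y := x * (Real.log x)^(z.re+6) with hY
  have hIntg : ∫ u in (1:ℝ)..x, MM z 8 c u = ∑ j ∈ Finset.range 7,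
      m j * ∫ u in (1:ℝ)..x, ((Real.log u : ℝ) : ℂ)^(z+(8:ℕ)-j-1) := by
    simp only [MM]
    rw [intervalIntegral.integral_finsetSum]
    · refine Finset.sum_congr rfl fun j hj => ?_
      rw [intervalIntegral.integral_const_mul]
    · intro j hj
      rw [Finset.mem_range] at hj
      have : (j:ℝ) ≤ 6 := by exact_mod_cast (by omega : j ≤ 6)
      refine IntervalIntegrable.const_mul ?_ _
      exact ii_of_int (logpow_int (z+(8:ℕ)-j) 2 (by simp; linarith) (by simp)).1 hx1.le
  rw [Finset.sum_range_succ'] at hIntg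
  have h1 : ‖∑ j ∈ Finset.range 6, m (j+1) * ∫ u in (1:ℝ)..x,
      ((Real.log u : ℝ) : ℂ)^(z+(8:ℕ)-(j+1:ℕ)-1)‖ ≤ B * Y := by
    rw [hB, Finset.sum_mul]
    refine norm_sum_le_of_le _ fun j hj => ?_
    rw [Finset.mem_range] at hj
    have hj5 : (j:ℝ) ≤ 5 := by exact_mod_cast (by omega : j ≤ 5)
    have hj0 : (0:ℝ) ≤ j := by positivity
    rw [norm_mul]
    refine mul_le_mul_of_nonneg_left ?_ (norm_nonneg _)
    refine (logint _ (by simp; linarith) hx).trans ?_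
    rw [hY]
    refine mul_le_mul_of_nonneg_left ?_ hx0.le
    refine Real.rpow_le_rpow_of_exponent_le hl ?_
    simp; linarith
  have h2 : ∫ u in (1:ℝ)..x, ((Real.log u : ℝ) : ℂ)^(z+(8:ℕ)-(0:ℕ)-1) =
      x * ((Real.log x : ℝ) : ℂ)^(z+7) - (z+7) * ∫ u in (1:ℝ)..x, ((Real.log u : ℝ) : ℂ)^(z+6) := by
    have := logint2 (z+7) (by simp; linarith) hx1.le
    rw [show z + 7 - 1 = z + 6 by ring] at this
    rw [show z+(8:ℕ)-(0:ℕ)-1 = z + 7 by push_cast; ring, this]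
  have h3 : ‖∫ u in (1:ℝ)..x, ((Real.log u : ℝ) : ℂ)^(z+6)‖ ≤ Y := by
    have := logint (z+6) (by simp; linarith) hx
    simpa using this
  have h4 : ‖EE a z 8 c x‖ ≤ C * Y := by
    refine (hE x hx).trans ?_
    rw [hY, mul_assoc]
    refine mul_le_mul_of_nonneg_left (mul_le_mul_of_nonneg_left ?_ hx0.le) hC.le
    rw [← Real.rpow_natCast]
    exact Real.rpow_le_rpow_of_exponent_le hl (by push_cast; linarith)
  have e : TT a 8 x - (Gamma z)⁻¹ * FT a z 1 * x * ((Real.log x : ℝ) : ℂ)^(z+7) =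
      EE a z 8 c x - m 0 * (z+7) * (∫ u in (1:ℝ)..x, ((Real.log u : ℝ) : ℂ)^(z+6)) +
      ∑ j ∈ Finset.range 6, m (j+1) * ∫ u in (1:ℝ)..x,
      ((Real.log u : ℝ) : ℂ)^(z+(8:ℕ)-(j+1:ℕ)-1) := by
    rw [EE, hIntg, h2, ← hm0]; ring
  rw [e, mul_assoc _ x, ← hY]
  refine (norm_add_le _ _).trans ?_
  have h5 := norm_sub_le (EE a z 8 c x) (m 0 * (z+7) * (∫ u in (1:ℝ)..x, ((Real.log u : ℝ) : ℂ)^(z+6)))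
  rw [norm_mul, norm_mul (m 0)] at h5
  have h6 := mul_le_mul_of_nonneg_left h3 (mul_nonneg (norm_nonneg (m 0)) (norm_nonneg (z+7)))
  linarith
end

section
open Complex Set Filter Topology MeasureTheory

lemma TT_upper {a : ℕ → ℂ} {z : ℂ} (h : Dat a z) : ∃ C > 0, ∀ u : ℝ, 2 ≤ u →
    ‖TT a 8 u‖ ≤ C * u * (Real.log u)^(z.re+7) := by
  obtain ⟨C, hC, hT⟩ := TT_asym h
  have hz' := abs_le.1 ((Complex.abs_re_le_norm z).trans h.norm_z)
  set A := (Gamma z)⁻¹ * FT a z 1 with hA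
  refine ⟨C + ‖A‖ + 1, by positivity, fun u hu => ?_⟩
  have hu1 : 1 < u := by linarith
  have hu0 : 0 < u := by linarith
  have hl0 := Real.log_pos hu1
  have hp : 0 ≤ u * (Real.log u)^(z.re+7) := by positivity
  rcases le_total (Real.exp 1) u with hx | hx
  · obtain ⟨-, hl⟩ := exp_one_facts hx
    have h1 := hT u hx
    have h2 : ‖A * u * ((Real.log u : ℝ) : ℂ)^(z+7)‖ = ‖A‖ * (u * (Real.log u)^(z.re+7)) := by
      rw [norm_mul, norm_mul, norm_logpow hu1, Complex.norm_real, Real.norm_of_nonneg hu0.le]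
      simp [mul_assoc]
    have h3 : (Real.log u)^(z.re+6) ≤ (Real.log u)^(z.re+7) :=
      Real.rpow_le_rpow_of_exponent_le hl (by linarith)
    have h4 := norm_le_norm_add_norm_sub' (TT a 8 u) (A * u * ((Real.log u : ℝ) : ℂ)^(z+7))
    have h5 : C * u * (Real.log u)^(z.re+6) ≤ C * u * (Real.log u)^(z.re+7) :=
      mul_le_mul_of_nonneg_left h3 (by positivity)
    rw [h2] at h4
    nlinarith
  · have hl : Real.log u ≤ 1 := by
      rw [Real.log_le_iff_le_exp hu0]; exact hx
    have h1 := TT_norm h.bd 8 hu1.le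
    have h2 : (Real.log u)^8 ≤ (Real.log u)^(z.re+7) := by
      rw [← Real.rpow_natCast]
      exact Real.rpow_le_rpow_of_exponent_ge hl0 hl (by push_cast; linarith)
    have h3 := mul_le_mul_of_nonneg_left h2 hu0.le
    have h4 : 0 ≤ (C + ‖A‖) * (u * (Real.log u)^(z.re+7)) := by positivity
    nlinarith

lemma log_ratio {r : ℝ} (h1 : -3 ≤ r) (h2 : r ≤ 0) {u x : ℝ} (hu : 2 ≤ u) (hx : u ≤ x) :
    (Real.log u)^r ≤ 14^3 * ((x^(1/2:ℝ) * (Real.log x)^r) * u^(-(1/2):ℝ)) := by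
  have hu0 : 0 < u := by linarith
  have hx0 : 0 < x := by linarith
  have hlu : 0 < Real.log u := Real.log_pos (by linarith)
  have hlx : 0 < Real.log x := Real.log_pos (by linarith)
  have hl2 : 1/2 ≤ Real.log u := by
    have := Real.log_two_gt_d9
    have := Real.log_le_log (by norm_num) hu
    linarith
  set t := x/u with ht
  have ht1 : 1 ≤ t := by rw [ht, one_le_div hu0]; exact hx
  have ht0 : 0 < t := by linarith
  have hxt : x = t * u := by rw [ht]; field_simp
  set q := t^(1/6:ℝ) with hq
  have hq1 : 1 ≤ q := Real.one_le_rpow ht1 (by norm_num)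
  have hlt : Real.log t ≤ 6 * q := by
    have := Real.log_le_rpow_div ht0.le (ε := 1/6) (by norm_num)
    rw [← hq] at this; linarith
  have hr : Real.log x ≤ 14 * q * Real.log u := by
    have hlt0 := Real.log_nonneg ht1
    rw [hxt, Real.log_mul ht0.ne' hu0.ne']
    nlinarith
  have hq3 : q^3 = x^(1/2:ℝ) * u^(-(1/2):ℝ) := by
    rw [hq, ← Real.rpow_natCast, ← Real.rpow_mul ht0.le, ht, Real.div_rpow hx0.le hu0.le,
      Real.rpow_neg hu0.le]
    norm_num; rfl
  set y := 14 * q with hy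
  have hy1 : 1 ≤ y := by linarith
  have h3 : (y * Real.log u)^r ≤ (Real.log x)^r := Real.rpow_le_rpow_of_nonpos hlx hr h2
  rw [Real.mul_rpow (by linarith) hlu.le] at h3
  have h4 : y^(-3:ℝ) ≤ y^r := Real.rpow_le_rpow_of_exponent_le hy1 h1
  have h5 : y^(-3:ℝ) = (y^3)⁻¹ := by
    rw [Real.rpow_neg (by linarith)]; norm_cast
  have hy3 : 0 < y^3 := by positivity
  have hlr : 0 < (Real.log u)^r := Real.rpow_pos_of_pos hlu r
  have h6 : (y^3)⁻¹ * (Real.log u)^r ≤ (Real.log x)^r := by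
    refine le_trans ?_ h3
    rw [← h5]; exact mul_le_mul_of_nonneg_right h4 hlr.le
  have h7 : (Real.log u)^r ≤ y^3 * (Real.log x)^r := by
    rwa [inv_mul_le_iff₀ hy3] at h6
  refine h7.trans (le_of_eq ?_)
  rw [hy, mul_pow, hq3]; ring

theorem core {a : ℕ → ℂ} {z : ℂ} (h : Dat a z) : ∃ C > 0, ∃ N₀ : ℕ, ∀ N : ℕ, N₀ ≤ N →
    ‖∑ n ∈ Finset.Icc 1 N, a n - FT a z 1 * (Gamma z)⁻¹ * N * ((Real.log N : ℝ) : ℂ)^(z-1)‖ ≤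
      C * N * (Real.log N)^(z.re-2) := by
  obtain ⟨C, hC, hT⟩ := TT_asym h
  obtain ⟨D, hD, hU⟩ := TT_upper h
  obtain ⟨K, hK, hlog⟩ := log_pow_le 3 one_pos
  have hz' := abs_le.1 ((Complex.abs_re_le_norm z).trans h.norm_z)
  refine ⟨C + 8 * D * 14^3 * 2 + K, by positivity, 3, fun N hN => ?_⟩
  have hN3 : (3:ℝ) ≤ N := by exact_mod_cast hN
  have hNe : Real.exp 1 ≤ N := by
    have := Real.exp_one_lt_d9; linarith
  obtain ⟨hN1, hl⟩ := exp_one_facts hNe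
  have hN0 : (0:ℝ) < N := by linarith
  set L := Real.log N with hL
  have hL0 : 0 < L := by linarith
  set f : ℝ → ℂ := fun t => ((((Real.log t)^8)⁻¹ : ℝ) : ℂ) with hf
  have hfd : ∀ t : ℝ, 2 ≤ t → HasDerivAt f ((-(8 * (Real.log t)^7 * t⁻¹) / ((Real.log t)^8)^2 : ℝ) : ℂ) t := by
    intro t ht
    have hlt : 0 < Real.log t := Real.log_pos (by linarith)
    have d1 := (Real.hasDerivAt_log (by linarith : t ≠ 0)).fun_pow 8
    have d2 := d1.fun_inv (by positivity)
    refine (d2.ofReal_comp).congr_deriv ?_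
    norm_num
  have hderiv : ∀ t ∈ Icc (2:ℝ) N, deriv f t = ((-(8 * (Real.log t)^7 * t⁻¹) / ((Real.log t)^8)^2 : ℝ) : ℂ) :=
    fun t ht => (hfd t ht.1).deriv
  have hfi : IntegrableOn (deriv f) (Icc (2:ℝ) N) := by
    refine IntegrableOn.congr_fun ?_ (fun t ht => (hderiv t ht).symm) measurableSet_Icc
    refine ContinuousOn.integrableOn_compact isCompact_Icc ?_
    refine Complex.continuous_ofReal.comp_continuousOn ?_
    have hlc : ContinuousOn Real.log (Icc (2:ℝ) N) :=
      Real.continuousOn_log.mono fun t ht => by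
        have := ht.1
        simp only [mem_compl_iff, mem_singleton_iff]; linarith
    refine ContinuousOn.div ?_ ((hlc.pow 8).pow 2) ?_
    · refine ((continuousOn_const.mul (hlc.pow 7)).mul (ContinuousOn.inv₀ continuousOn_id ?_)).neg
      intro t ht; have := ht.1; simp only [id]; linarith
    · intro t ht
      have : 0 < Real.log t := Real.log_pos (by linarith [ht.1])
      positivity
  have hb0 : bb a 8 0 = 0 := by simp [bb]
  have hb1 : bb a 8 1 = 0 := by simp [bb]
  have abel := sum_mul_eq_sub_integral_mul₁ (bb a 8) hb0 hb1 (N:ℝ) (f := f)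
    (fun t ht => (hfd t ht.1).differentiableAt) hfi
  rw [Nat.floor_natCast] at abel
  have hT0 : ∀ t : ℝ, ∑ k ∈ Finset.Icc 0 ⌊t⌋₊, bb a 8 k = TT a 8 t := by
    intro t
    rw [TT, Finset.Icc_eq_cons_Ioc (Nat.zero_le _), Finset.sum_cons, hb0, zero_add]
    rfl
  have hTN : ∑ k ∈ Finset.Icc 0 N, bb a 8 k = TT a 8 N := by
    rw [← hT0, Nat.floor_natCast]
  simp only [hT0] at abel
  rw [hTN] at abel
  have hS : ∑ n ∈ Finset.Icc 1 N, a n = 1 + ∑ k ∈ Finset.Icc 0 N, f k * bb a 8 k := by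
    have e1 : ∑ k ∈ Finset.Icc 0 N, f k * bb a 8 k = ∑ k ∈ Finset.Icc 1 N, f k * bb a 8 k := by
      rw [Finset.Icc_eq_cons_Ioc (Nat.zero_le _), Finset.sum_cons, hb0, mul_zero, zero_add]
      rfl
    rw [e1, Finset.Icc_eq_cons_Ioc (by omega : 1 ≤ N), Finset.sum_cons, Finset.sum_cons, hb1, mul_zero,
      zero_add, h.one]
    congr 1
    refine Finset.sum_congr rfl fun n hn => ?_
    rw [Finset.mem_Ioc] at hn
    have hln : Real.log n ≠ 0 := (Real.log_pos (by exact_mod_cast hn.1)).ne'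
    have hln' : ((Real.log n : ℝ) : ℂ) ≠ 0 := by exact_mod_cast hln
    simp only [hf, bb]
    rw [Complex.ofReal_inv, Complex.ofReal_pow]
    field_simp
  have hIntg : ‖∫ t in Ioc (2:ℝ) N, deriv f t * TT a 8 t‖ ≤ 8 * D * 14^3 * 2 * (N * L^(z.re-2)) := by
    have hb : ∀ t ∈ Ioc (2:ℝ) N, ‖deriv f t * TT a 8 t‖ ≤
        (8 * D * 14^3 * ((N:ℝ)^(1/2:ℝ) * L^(z.re-2))) * t^(-(1/2):ℝ) := by
      intro t ht
      have ht0 : 0 < t := by linarith [ht.1]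
      have hlt : 0 < Real.log t := Real.log_pos (by linarith [ht.1])
      rw [hderiv t ⟨ht.1.le, ht.2⟩, norm_mul, Complex.norm_real, Real.norm_eq_abs, neg_div, abs_neg,
        abs_of_nonneg (by positivity)]
      have h1 := hU t ht.1.le
      have h2 := log_ratio (r := z.re-2) (by linarith) (by linarith) ht.1.le ht.2
      calc _ ≤ 8 * (Real.log t)^7 * t⁻¹ / ((Real.log t)^8)^2 * (D * t * (Real.log t)^(z.re+7)) :=
            mul_le_mul_of_nonneg_left h1 (by positivity)
        _ = 8 * D * ((Real.log t)^(z.re+7) * ((Real.log t)^9)⁻¹) := by field_simp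
        _ = 8 * D * (Real.log t)^(z.re-2) := by
            rw [← Real.rpow_natCast (Real.log t) 9, ← Real.rpow_neg hlt.le, ← Real.rpow_add hlt]
            congr 2; push_cast; ring
        _ ≤ 8 * D * (14^3 * (((N:ℝ)^(1/2:ℝ) * L^(z.re-2)) * t^(-(1/2):ℝ))) :=
            mul_le_mul_of_nonneg_left h2 (by positivity)
        _ = _ := by ring
    have hii : IntervalIntegrable (fun t : ℝ => t^(-(1/2):ℝ)) volume 2 N :=
      intervalIntegral.intervalIntegrable_rpow' (by norm_num)
    have hi2 : IntegrableOn (fun t : ℝ => t^(-(1/2):ℝ)) (Ioc 2 N) :=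
      (intervalIntegrable_iff_integrableOn_Ioc_of_le (by linarith)).1 hii
    have h1 := norm_integral_le_of_norm_le (hi2.const_mul (8 * D * 14^3 * ((N:ℝ)^(1/2:ℝ) * L^(z.re-2))))
      ((ae_restrict_mem measurableSet_Ioc).mono hb)
    refine h1.trans ?_
    rw [integral_const_mul, ← intervalIntegral.integral_of_le (by linarith),
      integral_rpow (Or.inl (by norm_num))]
    have hhalf : (N:ℝ)^(1/2:ℝ) * (N:ℝ)^(1/2:ℝ) = N := by
      rw [← Real.rpow_add hN0]; norm_num
    have h2 : (((N:ℝ)^(-(1/2)+1:ℝ) - 2^(-(1/2)+1:ℝ)) / (-(1/2)+1)) ≤ 2 * (N:ℝ)^(1/2:ℝ) := by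
      norm_num
      have : (0:ℝ) ≤ 2^(1/2:ℝ) := by positivity
      rw [div_le_iff₀ (by norm_num)]
      norm_num at this ⊢
      linarith
    calc _ ≤ (8 * D * 14^3 * ((N:ℝ)^(1/2:ℝ) * L^(z.re-2))) * (2 * (N:ℝ)^(1/2:ℝ)) :=
          mul_le_mul_of_nonneg_left h2 (by positivity)
      _ = 8 * D * 14^3 * 2 * (((N:ℝ)^(1/2:ℝ) * (N:ℝ)^(1/2:ℝ)) * L^(z.re-2)) := by ring
      _ = _ := by rw [hhalf]
  have hLc : ((L:ℝ):ℂ) ≠ 0 := by exact_mod_cast hL0.ne'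
  have hmain : ‖f N * TT a 8 N - FT a z 1 * (Gamma z)⁻¹ * N * ((L : ℝ) : ℂ)^(z-1)‖ ≤
      C * (N * L^(z.re-2)) := by
    have e : f N * TT a 8 N - FT a z 1 * (Gamma z)⁻¹ * N * ((L : ℝ) : ℂ)^(z-1) =
        f N * (TT a 8 N - (Gamma z)⁻¹ * FT a z 1 * (N:ℝ) * ((L : ℝ) : ℂ)^(z+7)) := by
      have : f N * ((L : ℝ) : ℂ)^(z+7) = ((L : ℝ) : ℂ)^(z-1) := by
        simp only [hf]
        rw [show z + 7 = z - 1 + (8:ℕ) by push_cast; ring, Complex.cpow_add _ _ hLc, Complex.cpow_natCast]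
        rw [← hL, Complex.ofReal_inv, Complex.ofReal_pow]
        field_simp
      rw [← this, Complex.ofReal_natCast]; ring
    rw [e, norm_mul]
    have hfn : ‖f N‖ = (L^8)⁻¹ := by
      simp only [hf]; rw [Complex.norm_real, Real.norm_of_nonneg (by positivity)]
    rw [hfn]
    refine (mul_le_mul_of_nonneg_left (hT N hNe) (by positivity)).trans (le_of_eq ?_)
    rw [← hL]
    have : (L^8)⁻¹ * L^(z.re+6) = L^(z.re-2) := by
      rw [← Real.rpow_natCast L 8, ← Real.rpow_neg hL0.le, ← Real.rpow_add hL0]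
      congr 1; push_cast; ring
    rw [← this]; ring
  have hone : 1 ≤ K * (N * L^(z.re-2)) := by
    have h1 := hlog N hN1.le
    rw [Real.rpow_one, ← hL] at h1
    have h2 : L^(-3:ℝ) ≤ L^(z.re-2) := Real.rpow_le_rpow_of_exponent_le hl (by linarith)
    have h3 : L^(-3:ℝ) = (L^3)⁻¹ := by rw [Real.rpow_neg hL0.le]; norm_cast
    have hL3 : 0 < L^3 := by positivity
    calc (1:ℝ) = L^3 * (L^3)⁻¹ := (mul_inv_cancel₀ hL3.ne').symm
      _ ≤ (K * N) * L^(z.re-2) := mul_le_mul h1 (h3 ▸ h2) (by positivity) (by positivity)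
      _ = _ := by ring
  rw [hS, abel]
  have e : 1 + (f N * TT a 8 N - ∫ t in Ioc (2:ℝ) N, deriv f t * TT a 8 t) -
      FT a z 1 * (Gamma z)⁻¹ * N * ((L : ℝ) : ℂ)^(z-1) =
      1 + (f N * TT a 8 N - FT a z 1 * (Gamma z)⁻¹ * N * ((L : ℝ) : ℂ)^(z-1)) -
      ∫ t in Ioc (2:ℝ) N, deriv f t * TT a 8 t := by ring
  rw [e]
  have n1 := norm_sub_le (1 + (f N * TT a 8 N - FT a z 1 * (Gamma z)⁻¹ * N * ((L : ℝ) : ℂ)^(z-1)))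
    (∫ t in Ioc (2:ℝ) N, deriv f t * TT a 8 t)
  have n2 := norm_add_le (1:ℂ) (f N * TT a 8 N - FT a z 1 * (Gamma z)⁻¹ * N * ((L : ℝ) : ℂ)^(z-1))
  rw [norm_one] at n2
  linarith
end

/-- If `F_{t,p}` is holomorphic on `Re s > 1/2` with
`Σ_{n ≥ 1} e(w(n)t/p) n^{−s} = ζ(s)^{e(t/p)}·F_{t,p}(s)` for `Re s > 1`, then
`Σ_{n ≤ N} e(w(n)t/p) = (F_{t,p}(1)/Γ(e(t/p)))·N·(log N)^{e(t/p)−1}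
  + O(N·(log N)^{cos(2πt/p)−2})`. -/
theorem exp_sum_asymptotic (w : ℕ → ℕ)
    (hw_add : ∀ m n : ℕ, 1 ≤ m → 1 ≤ n → Nat.Coprime m n → w (m * n) = w m + w n)
    (hw_prime : ∀ q : ℕ, Nat.Prime q → w q = 1)
    (p : ℕ) (hp : p.Prime) (t : ℕ) (ht1 : 1 ≤ t) (ht2 : t ≤ p - 1)
    (F : ℂ → ℂ) (hF : DifferentiableOn ℂ F {s : ℂ | 1 / 2 < s.re})
    (hFid : ∀ s : ℂ, 1 < s.re →
      HasSum (fun n : ℕ => eTwoPi ((w (n + 1) : ℝ) * t / p) / ((n : ℂ) + 1) ^ s)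
        (Complex.exp (eTwoPi ((t : ℝ) / p) * logZetaSeries s) * F s)) :
    ∃ C : ℝ, 0 < C ∧ ∃ N₀ : ℕ, ∀ N : ℕ, N₀ ≤ N →
      ‖(∑ n ∈ Finset.Icc 1 N, eTwoPi ((w n : ℝ) * t / p)) -
          F 1 * (Complex.Gamma (eTwoPi ((t : ℝ) / p)))⁻¹ * N *
            Complex.exp ((eTwoPi ((t : ℝ) / p) - 1) * Real.log (Real.log N))‖ ≤
        C * N * (Real.log N) ^ (Real.cos (2 * Real.pi * t / p) - 2) := by
  have hnorm : ∀ x : ℝ, ‖eTwoPi x‖ = 1 := by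
    intro x
    rw [eTwoPi, show (2 * Real.pi * Complex.I * x : ℂ) = ((2 * Real.pi * x : ℝ) : ℂ) * Complex.I by
      push_cast; ring, Complex.norm_exp_ofReal_mul_I]
  have hadd : ∀ x y : ℝ, eTwoPi (x + y) = eTwoPi x * eTwoPi y := by
    intro x y
    rw [eTwoPi, eTwoPi, eTwoPi, ← Complex.exp_add]
    congr 1; push_cast; ring
  have hre : (eTwoPi ((t : ℝ) / p)).re = Real.cos (2 * Real.pi * t / p) := by
    rw [eTwoPi, show (2 * Real.pi * Complex.I * ((t / p : ℝ) : ℂ) : ℂ) =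
      ((2 * Real.pi * t / p : ℝ) : ℂ) * Complex.I by push_cast; ring, Complex.exp_ofReal_mul_I_re]
  set z : ℂ := eTwoPi ((t : ℝ) / p) with hz
  let a : ℕ → ℂ := fun n => if n = 0 then 0 else eTwoPi ((w n : ℝ) * t / p)
  have ha : ∀ n : ℕ, n ≠ 0 → a n = eTwoPi ((w n : ℝ) * t / p) := fun n hn => if_neg hn
  have ha0 : a 0 = 0 := if_pos rfl
  have hw1 : w 1 = 0 := by
    have := hw_add 1 1 le_rfl le_rfl (by simp)
    simp at this; exact this
  have ha1 : a 1 = 1 := by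
    rw [ha 1 one_ne_zero, hw1]; simp [eTwoPi]
  have hD : Dat a z := by
    refine ⟨ha1, ?_, ?_, ?_, ha0⟩
    · intro m n hmn
      rcases Nat.eq_zero_or_pos m with rfl | hm
      · rw [zero_mul, ha0, zero_mul]
      rcases Nat.eq_zero_or_pos n with rfl | hn
      · rw [mul_zero, ha0, mul_zero]
      rw [ha _ (Nat.mul_pos hm hn).ne', ha _ hm.ne', ha _ hn.ne', hw_add m n hm hn hmn, ← hadd]
      congr 1; push_cast; ring
    · intro n
      rcases Nat.eq_zero_or_pos n with rfl | hn
      · rw [ha0]; simp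
      · rw [ha _ hn.ne', hnorm]
    · intro q hq
      rw [ha q hq.ne_zero, hw_prime q hq, hz]
      congr 1; push_cast; ring
  have hEq : ∀ s : ℂ, 1 < s.re → F s = FT a z s := by
    intro s hs
    have h1 := D_eq hD hs
    have h2 : HasSum (LSeries.term a s) (LSeries a s) := (a_summable hD.bd hs).hasSum
    rw [← hasSum_nat_add_iff' 1] at h2
    simp only [Finset.range_one, Finset.sum_singleton, LSeries.term_zero, sub_zero] at h2
    have h3 := hFid s hs
    have h4 : (fun n : ℕ => eTwoPi ((w (n + 1) : ℝ) * t / p) / ((n : ℂ) + 1) ^ s) =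
        fun n : ℕ => LSeries.term a s (n + 1) := by
      funext n
      rw [LSeries.term_of_ne_zero (Nat.succ_ne_zero n), ha _ (Nat.succ_ne_zero n)]
      push_cast; rfl
    rw [h4] at h3
    have h5 := h3.unique h2
    have h6 : logZetaSeries s = LZ s := LZ_series hs
    rw [h1, h6, ZZ] at h5
    exact mul_left_cancel₀ (Complex.exp_ne_zero _) h5
  have hF1 : F 1 = FT a z 1 := by
    have c1 : ContinuousAt F 1 := by
      refine (hF.differentiableAt ?_).continuousAt
      exact (isOpen_lt continuous_const Complex.continuous_re).mem_nhds (by norm_num)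
    have c2 : ContinuousAt (FT a z) 1 := by
      refine ((FT_BigG hD).1.differentiableAt ?_).continuousAt
      exact (isOpen_lt continuous_const Complex.continuous_re).mem_nhds (by norm_num)
    have hu : Filter.Tendsto (fun n : ℕ => (1 : ℂ) + ((1 / ((n : ℝ) + 1) : ℝ) : ℂ)) Filter.atTop (nhds 1) := by
      have := (Complex.continuous_ofReal.tendsto 0).comp (tendsto_one_div_add_atTop_nhds_zero_nat (𝕜 := ℝ))
      simpa using this.const_add 1
    refine tendsto_nhds_unique (c1.tendsto.comp hu) ((c2.tendsto.comp hu).congr fun n => ?_)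
    refine (hEq _ ?_).symm
    rw [Complex.add_re, Complex.ofReal_re, Complex.one_re]
    have : (0 : ℝ) < 1 / ((n : ℝ) + 1) := by positivity
    linarith
  obtain ⟨C, hC, N₀, hN⟩ := core hD
  refine ⟨C, hC, max N₀ 3, fun N hNN => ?_⟩
  have h := hN N ((le_max_left _ _).trans hNN)
  have hN3 : 3 ≤ N := (le_max_right _ _).trans hNN
  have hl : 0 < Real.log N := Real.log_pos (by exact_mod_cast (by omega : 1 < N))
  have hsum : ∑ n ∈ Finset.Icc 1 N, a n = ∑ n ∈ Finset.Icc 1 N, eTwoPi ((w n : ℝ) * t / p) :=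
    Finset.sum_congr rfl fun n hn => ha n (by have := (Finset.mem_Icc.1 hn).1; omega)
  rw [hsum, Complex.cpow_def_of_ne_zero (by exact_mod_cast hl.ne'), ← Complex.ofReal_log hl.le,
    mul_comm _ (z - 1), ← hF1, hre] at h
  exact h
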